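/- Gordan's theorem for joint covariants: let V₁, V₂ be spaces of binary forms and let A = {f₁, …, f_p} ⊂ Cov(V₁), B = {g₁, …, g_q} ⊂ Cov(V₂) be finite generating sets of homogeneous covariants of orders a₁, …, a_p and b₁, …, b_q respectively. Consider the linear Diophantine system in nonnegative integer unknowns (α₁,…,α_p, β₁,…,β_q, u, v, r): a₁α₁ + … + a_pα_p = u + r and b₁β₁ + … + b_qβ_q = v + r. Then the set of irreducible solutions (nonzero solutions that are not the sum of two nonzero solutions) is finite, and Cov(V₁ ⊕ V₂) is generated as a ℂ-algebra by the finitely many transvectants ⟨f₁^{α₁}⋯f_p^{α_p}, g₁^{β₁}⋯g_q^{β_q}⟩_r associated to the irreducible solutions. -/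

import Mathlib

noncomputable section

open MvPolynomial

/-- The group `SL(2,ℂ)`. -/
abbrev SL2 : Type := Matrix.SpecialLinearGroup (Fin 2) ℂ

/-- Coordinates on `V ⊕ ℂ²`, where `V = ⊕ i, S_{ν i}` is a space of binary forms:
for each summand `S_{ν i}` there are `ν i + 1` coefficient coordinates, and there are
two extra coordinates for the variables `(x, y)` of `ℂ²`. -/
abbrev Var {ι : Type} (ν : ι → ℕ) : Type := (Σ i : ι, Fin (ν i + 1)) ⊕ Fin 2

/-- The coordinate ring `ℂ[V ⊕ ℂ²]`. -/
abbrev CoordRing {ι : Type} (ν : ι → ℕ) : Type := MvPolynomial (Var ν) ℂ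

/-- The binary form of degree `n` with coefficient vector `a`. -/
def form (n : ℕ) (a : Fin (n + 1) → ℂ) : MvPolynomial (Fin 2) ℂ :=
  ∑ i : Fin (n + 1), MvPolynomial.C (a i) * X 0 ^ (n - (i : ℕ)) * X 1 ^ (i : ℕ)

/-- Substitution `x ↦ g⁻¹ · x` on `ℂ[x,y]`; this sends a degree-`n` binary form `f`
to the form `g · f = f ∘ g⁻¹`. -/
def subst2 (g : SL2) : MvPolynomial (Fin 2) ℂ →ₐ[ℂ] MvPolynomial (Fin 2) ℂ :=
  aeval fun i => ∑ j : Fin 2, MvPolynomial.C ((g⁻¹).1 i j) * X j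

/-- The coefficient vector of a degree-`n` binary form. -/
def coeffOf (n : ℕ) (p : MvPolynomial (Fin 2) ℂ) (i : Fin (n + 1)) : ℂ :=
  MvPolynomial.coeff (Finsupp.single 0 (n - (i : ℕ)) + Finsupp.single 1 ((i : ℕ))) p

/-- The action of `g ∈ SL(2,ℂ)` on the coefficient vector of a degree-`n` binary form,
corresponding to `g · f := f ∘ g⁻¹`. -/
def coeffAct (g : SL2) (n : ℕ) (a : Fin (n + 1) → ℂ) : Fin (n + 1) → ℂ :=
  coeffOf n (subst2 g (form n a))

/-- The action of `g ∈ SL(2,ℂ)` on points of `V ⊕ ℂ²`: `( f, x ) ↦ ( g·f, g·x )`. -/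
def ptAct {ι : Type} (ν : ι → ℕ) (g : SL2) (pt : Var ν → ℂ) : Var ν → ℂ :=
  Sum.elim
    (fun c => coeffAct g (ν c.1) (fun k => pt (Sum.inl ⟨c.1, k⟩)) c.2)
    (fun i => ∑ j : Fin 2, (g).1 i j * pt (Sum.inr j))

/-- The covariant algebra `Cov(V) := ℂ[V ⊕ ℂ²]^{SL(2,ℂ)}`: the polynomial functions `p`
on `V ⊕ ℂ²` with `p(g·f, g·x) = p(f, x)` for all `g`, i.e. `(g·p) = p` for all `g`. -/
def Covariants {ι : Type} (ν : ι → ℕ) : Subalgebra ℂ (CoordRing ν) where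
  carrier := {p | ∀ (g : SL2) (pt : Var ν → ℂ), eval (ptAct ν g pt) p = eval pt p}
  mul_mem' := by
    intro a b ha hb g pt
    simp only [map_mul, ha g pt, hb g pt]
  one_mem' := by intro g pt; simp
  add_mem' := by
    intro a b ha hb g pt
    simp only [map_add, ha g pt, hb g pt]
  zero_mem' := by intro g pt; simp
  algebraMap_mem' := by intro c g pt; simp [MvPolynomial.algebraMap_eq]

/-- The weight giving the natural bigraduation of `ℂ[V ⊕ ℂ²]` by
(degree in the coefficients of `V`, order in `x`). -/
def wBi {ι : Type} (ν : ι → ℕ) : Var ν → ℕ × ℕ :=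
  Sum.elim (fun _ => (1, 0)) (fun _ => (0, 1))

/-- `V ⊕ ℂ²` coordinates together with three pairs of variables
`(x,y), (x_α,y_α), (x_β,y_β)` (indexed by `0`, `1`, `2`). -/
abbrev TVar {ι : Type} (ν : ι → ℕ) : Type := (Σ i : ι, Fin (ν i + 1)) ⊕ (Fin 3 × Fin 2)

abbrev TRing {ι : Type} (ν : ι → ℕ) : Type := MvPolynomial (TVar ν) ℂ

/-- Embed `ℂ[V ⊕ ℂ²]` into `TRing ν`, sending `(x,y)` to the pair indexed by `a`
and keeping the coefficients of `V` as constants. -/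
def embT {ι : Type} (ν : ι → ℕ) (a : Fin 3) : CoordRing ν →ₐ[ℂ] TRing ν :=
  rename (Sum.map id fun i => (a, i))

/-- Partial derivative on `TRing ν` as `ℂ`-linear endomorphism. -/
def pdT {ι : Type} (ν : ι → ℕ) (v : Fin 3 × Fin 2) : Module.End ℂ (TRing ν) :=
  (pderiv (Sum.inr v)).toLinearMap

/-- The Cayley operator `Ω_{ab}`. -/
def OmegaT {ι : Type} (ν : ι → ℕ) (a b : Fin 3) : Module.End ℂ (TRing ν) :=
  pdT ν (a, 0) * pdT ν (b, 1) - pdT ν (a, 1) * pdT ν (b, 0)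

/-- The polarization operator `σ_a := x·∂/∂x_a + y·∂/∂y_a`. -/
def SigmaT {ι : Type} (ν : ι → ℕ) (a : Fin 3) : Module.End ℂ (TRing ν) :=
  (LinearMap.mulLeft ℂ (X (Sum.inr (0, 0)) : TRing ν) : Module.End ℂ (TRing ν)) * pdT ν (a, 0)
    + (LinearMap.mulLeft ℂ (X (Sum.inr (0, 1)) : TRing ν) : Module.End ℂ (TRing ν)) * pdT ν (a, 1)

/-- The map `TRing ν → ℂ[V ⊕ ℂ²]` restricting to the diagonal `x_α = x_β = x`. -/
def collapseT {ι : Type} (ν : ι → ℕ) : TRing ν →ₐ[ℂ] CoordRing ν :=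
  aeval (Sum.elim (fun c => (X (Sum.inl c) : CoordRing ν)) (fun v => X (Sum.inr v.2)))

/-- The transvectant `⟨U, W⟩_r` of two covariants `U, W` of orders `u₀`, `w₀`:
`⟨U,W⟩_r := Ω_{αβ}^r σ_α^{u₀−r} σ_β^{w₀−r} ( U(x_α,y_α)·W(x_β,y_β) )` when
`0 ≤ r ≤ min u₀ w₀` (the coefficients of `V` being carried along as constants),
and `⟨U,W⟩_r := 0` for `r > min u₀ w₀`. -/
def transvect {ι : Type} (ν : ι → ℕ) (u₀ w₀ r : ℕ) (U W : CoordRing ν) : CoordRing ν :=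
  if r ≤ min u₀ w₀ then
    collapseT ν ((OmegaT ν 1 2 ^ r)
      ((SigmaT ν 1 ^ (u₀ - r)) ((SigmaT ν 2 ^ (w₀ - r)) (embT ν 1 U * embT ν 2 W))))
  else 0

/-- The natural embedding `ℂ[V₁ ⊕ ℂ²] → ℂ[(V₁ ⊕ V₂) ⊕ ℂ²]`, realizing `Cov(V₁)`
as a subalgebra of `Cov(V₁ ⊕ V₂)`. -/
def embL {ι₁ ι₂ : Type} (n : ι₁ → ℕ) (m : ι₂ → ℕ) :
    CoordRing n →ₐ[ℂ] CoordRing (Sum.elim n m) :=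
  rename (Sum.map
    (fun c => (⟨Sum.inl c.1, c.2⟩ : Σ k : ι₁ ⊕ ι₂, Fin (Sum.elim n m k + 1))) id)

/-- The natural embedding `ℂ[V₂ ⊕ ℂ²] → ℂ[(V₁ ⊕ V₂) ⊕ ℂ²]`, realizing `Cov(V₂)`
as a subalgebra of `Cov(V₁ ⊕ V₂)`. -/
def embR {ι₁ ι₂ : Type} (n : ι₁ → ℕ) (m : ι₂ → ℕ) :
    CoordRing m →ₐ[ℂ] CoordRing (Sum.elim n m) :=
  rename (Sum.map
    (fun c => (⟨Sum.inr c.1, c.2⟩ : Σ k : ι₁ ⊕ ι₂, Fin (Sum.elim n m k + 1))) id)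

/-- The universal binary form of the `i`-th summand of `V`, viewed as a covariant
in `ℂ[V ⊕ ℂ²]` (for `ν i = 2`, this is "the generic binary quadratic `u`"). -/
def univForm {ι : Type} (ν : ι → ℕ) (i : ι) : CoordRing ν :=
  ∑ j : Fin (ν i + 1),
    X (Sum.inl ⟨i, j⟩) * X (Sum.inr 0) ^ (ν i - (j : ℕ)) * X (Sum.inr 1) ^ (j : ℕ)

/-- A solution `κ = (α, β, u, v, r)` of Gordan's linear Diophantine system
`S(A,B)`: `a₁α₁ + … + a_pα_p = u + r` and `b₁β₁ + … + b_qβ_q = v + r`. -/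
def IsGordanSol {p q : ℕ} (a : Fin p → ℕ) (b : Fin q → ℕ)
    (κ : (Fin p → ℕ) × (Fin q → ℕ) × ℕ × ℕ × ℕ) : Prop :=
  (∑ i, a i * κ.1 i) = κ.2.2.1 + κ.2.2.2.2 ∧
  (∑ j, b j * κ.2.1 j) = κ.2.2.2.1 + κ.2.2.2.2

/-- An *irreducible* solution of the system: a nonzero solution that is not the sum
of two nonzero solutions. -/
def IsIrreducibleGordanSol {p q : ℕ} (a : Fin p → ℕ) (b : Fin q → ℕ)
    (κ : (Fin p → ℕ) × (Fin q → ℕ) × ℕ × ℕ × ℕ) : Prop :=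
  IsGordanSol a b κ ∧ κ ≠ 0 ∧
    ∀ κ₁ κ₂, IsGordanSol a b κ₁ → IsGordanSol a b κ₂ → κ₁ ≠ 0 → κ₂ ≠ 0 → κ ≠ κ₁ + κ₂

namespace GordanCov

open Filter Topology

/-- The action of the one-parameter torus with weights `w` on points. -/
def dil {σ : Type*} (w : σ → ℤ) (s : ℂˣ) (pt : σ → ℂ) : σ → ℂ :=
  fun c => (s : ℂ) ^ w c * pt c

/-- A sequence of units of `ℂ` tending to infinity. -/
def seqUnit (i : ℕ) : ℂˣ := Units.mk0 ((i : ℂ) + 1) (Nat.cast_add_one_ne_zero i)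

theorem tendsto_seqUnit_inv : Tendsto (fun i => (seqUnit i : ℂ)⁻¹) atTop (𝓝 0) := by
  simpa [seqUnit] using tendsto_one_div_add_atTop_nhds_zero_nat (𝕜 := ℂ)

theorem tendsto_seqUnit_zpow {k : ℤ} (hk : k < 0) :
    Tendsto (fun i => (seqUnit i : ℂ) ^ k) atTop (𝓝 0) := by
  obtain ⟨n, rfl⟩ : ∃ n : ℕ, k = -((n : ℤ) + 1) := ⟨(-k - 1).toNat, by omega⟩
  have h := (tendsto_seqUnit_inv).pow (n + 1)
  rw [zero_pow (Nat.succ_ne_zero n)] at h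
  refine h.congr fun i => ?_
  rw [zpow_neg, inv_pow]
  norm_cast

theorem zpow_finset_sum {ι : Type*} (s : ℂˣ) (t : Finset ι) (k : ι → ℤ) :
    (s : ℂ) ^ (∑ i ∈ t, k i) = ∏ i ∈ t, (s : ℂ) ^ k i := by
  classical
  induction t using Finset.induction_on with
  | empty => simp
  | insert a t ha ih => rw [Finset.sum_insert ha, Finset.prod_insert ha, zpow_add₀ s.ne_zero, ih]

theorem prod_dil {σ : Type*} (w : σ → ℤ) (s : ℂˣ) (pt : σ → ℂ) (d : σ →₀ ℕ) :
    ∏ i ∈ d.support, dil w s pt i ^ d i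
      = (s : ℂ) ^ (Finsupp.weight w d) * ∏ i ∈ d.support, pt i ^ d i := by
  have : Finsupp.weight w d = ∑ i ∈ d.support, (d i : ℤ) * w i := by
    simp [Finsupp.weight_apply, Finsupp.sum]
  rw [this, zpow_finset_sum, ← Finset.prod_mul_distrib]
  refine Finset.prod_congr rfl fun i _ => ?_
  rw [dil, mul_pow, mul_comm (d i : ℤ), zpow_mul, zpow_natCast]

theorem eval_dil_eq_sum {σ : Type*} (w : σ → ℤ) (s : ℂˣ) (pt : σ → ℂ) (P : MvPolynomial σ ℂ) :
    eval (dil w s pt) P = ∑ d ∈ P.support,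
      (s : ℂ) ^ (Finsupp.weight w d) * (coeff d P * ∏ i ∈ d.support, pt i ^ d i) := by
  rw [eval_eq]
  refine Finset.sum_congr rfl fun d _ => ?_
  rw [prod_dil]
  ring

theorem eval_dil {σ : Type*} {w : σ → ℤ} {P : MvPolynomial σ ℂ} {l : ℤ}
    (hP : P.IsWeightedHomogeneous w l) (s : ℂˣ) (pt : σ → ℂ) :
    eval (dil w s pt) P = (s : ℂ) ^ l * eval pt P := by
  rw [eval_dil_eq_sum, eval_eq, Finset.mul_sum]
  refine Finset.sum_congr rfl fun d hd => ?_
  rw [hP (mem_support_iff.1 hd)]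

/-- The ring homomorphism corresponding to `dil`. -/
def dilHom {σ : Type*} (w : σ → ℤ) (s : ℂˣ) : MvPolynomial σ ℂ →ₐ[ℂ] MvPolynomial σ ℂ :=
  aeval fun c => C ((s : ℂ) ^ w c) * X c

theorem eval_dilHom {σ : Type*} (w : σ → ℤ) (s : ℂˣ) (P : MvPolynomial σ ℂ) (pt : σ → ℂ) :
    eval pt (dilHom w s P) = eval (dil w s pt) P := by
  induction P using MvPolynomial.induction_on with
  | C a => simp [dilHom]
  | add p q hp hq => simp [hp, hq]
  | mul_X p c hp =>
    rw [map_mul, map_mul, map_mul, hp]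
    simp [dilHom, dil]

theorem dilHom_monomial {σ : Type*} (w : σ → ℤ) (s : ℂˣ) (d : σ →₀ ℕ) (a : ℂ) :
    dilHom w s (monomial d a) = monomial d ((s : ℂ) ^ (Finsupp.weight w d) * a) := by
  refine MvPolynomial.funext fun pt => ?_
  rw [eval_dilHom, eval_dil (isWeightedHomogeneous_monomial w d a rfl), eval_monomial,
    eval_monomial, mul_assoc]

theorem coeff_dilHom {σ : Type*} (w : σ → ℤ) (s : ℂˣ) (d : σ →₀ ℕ) (P : MvPolynomial σ ℂ) :
    coeff d (dilHom w s P) = (s : ℂ) ^ (Finsupp.weight w d) * coeff d P := by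
  classical
  induction P using MvPolynomial.induction_on' with
  | monomial e a =>
    rw [dilHom_monomial, coeff_monomial, coeff_monomial]
    split_ifs with h
    · rw [h]
    · simp
  | add p q hp hq => rw [map_add, coeff_add, coeff_add, hp, hq, mul_add]

theorem isWeightedHomogeneous_of_eval_dil {σ : Type*} {w : σ → ℤ} {P : MvPolynomial σ ℂ} {l : ℤ}
    (h : ∀ (s : ℂˣ) (pt : σ → ℂ), eval (dil w s pt) P = (s : ℂ) ^ l * eval pt P) :
    P.IsWeightedHomogeneous w l := by
  intro d hd
  let s : ℂˣ := Units.mk0 2 two_ne_zero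
  have h1 : dilHom w s P = C ((s : ℂ) ^ l) * P :=
    MvPolynomial.funext fun pt => by rw [eval_dilHom, h]; simp
  have h2 := congrArg (coeff d) h1
  rw [coeff_dilHom, coeff_C_mul] at h2
  have h3 := congrArg norm (mul_right_cancel₀ hd h2)
  simp only [s, Units.val_mk0, norm_zpow, Complex.norm_ofNat] at h3
  exact zpow_right_injective₀ (by norm_num) (by norm_num) h3

/-- All monomials of `P` have weight at most `N`. -/
def WeightLE {σ : Type*} (w : σ → ℤ) (N : ℤ) (P : MvPolynomial σ ℂ) : Prop :=
  ∀ d ∈ P.support, Finsupp.weight w d ≤ N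

/-- The leading coefficient of `P` along the one-parameter torus, in degree `N`, is `Q`. -/
def HasTop {σ : Type*} (w : σ → ℤ) (N : ℤ) (P Q : MvPolynomial σ ℂ) : Prop :=
  ∀ pt : σ → ℂ, Tendsto (fun i => (seqUnit i : ℂ) ^ (-N) * eval (dil w (seqUnit i) pt) P) atTop
    (𝓝 (eval pt Q))

theorem WeightLE.tendsto {σ : Type*} {w : σ → ℤ} {N : ℤ} {P : MvPolynomial σ ℂ}
    (hP : WeightLE w N P) {pts : ℕ → σ → ℂ} {pt : σ → ℂ}
    (hpt : ∀ c, Tendsto (fun i => pts i c) atTop (𝓝 (pt c))) :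
    Tendsto (fun i => (seqUnit i : ℂ) ^ (-N) * eval (dil w (seqUnit i) (pts i)) P) atTop
      (𝓝 (eval pt (weightedHomogeneousComponent w N P))) := by
  classical
  have h1 : eval pt (weightedHomogeneousComponent w N P) = ∑ d ∈ P.support,
      (if Finsupp.weight w d = N then 1 else 0) * (coeff d P * ∏ i ∈ d.support, pt i ^ d i) := by
    rw [weightedHomogeneousComponent_apply, map_sum, Finset.sum_filter]
    refine Finset.sum_congr rfl fun d _ => ?_
    split_ifs
    · rw [one_mul, eval_monomial, Finsupp.prod]
    · rw [zero_mul]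
  simp_rw [h1, eval_dil_eq_sum, Finset.mul_sum]
  refine tendsto_finsetSum _ fun d hd => ?_
  simp_rw [← mul_assoc, mul_assoc _ (coeff d P)]
  refine Tendsto.mul ?_ (tendsto_const_nhds.mul (tendsto_finsetProd _ fun c _ => (hpt c).pow _))
  simp_rw [← zpow_add₀ (Units.ne_zero _)]
  split_ifs with h
  · simp [h]
  · exact tendsto_seqUnit_zpow (by have := hP d hd; omega)

theorem WeightLE.hasTop {σ : Type*} {w : σ → ℤ} {N : ℤ} {P : MvPolynomial σ ℂ}
    (hP : WeightLE w N P) : HasTop w N P (weightedHomogeneousComponent w N P) :=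
  fun _ => hP.tendsto fun _ => tendsto_const_nhds

theorem HasTop.weightLE {σ : Type*} {w : σ → ℤ} {N : ℤ} {P Q : MvPolynomial σ ℂ}
    (h : HasTop w N P Q) : WeightLE w N P := by
  classical
  by_contra hcon
  simp only [WeightLE, not_forall, not_le] at hcon
  obtain ⟨d₀, hd₀, hlt⟩ := hcon
  obtain ⟨d, hd, hmax⟩ := P.support.exists_max_image (Finsupp.weight w) ⟨d₀, hd₀⟩
  set M := Finsupp.weight w d with hM
  have hNM : N < M := hlt.trans_le (hmax d₀ hd₀)
  have hle : WeightLE w M P := hmax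
  have hzero : weightedHomogeneousComponent w M P = 0 := by
    refine MvPolynomial.funext fun pt => ?_
    refine tendsto_nhds_unique (hle.hasTop pt) ?_
    have := (tendsto_seqUnit_zpow (k := N - M) (by omega)).mul (h pt)
    rw [zero_mul] at this
    rw [map_zero]
    refine this.congr fun i => ?_
    rw [← mul_assoc, ← zpow_add₀ (Units.ne_zero _)]
    congr 2
    ring
  have := congrArg (coeff d) hzero
  rw [coeff_weightedHomogeneousComponent, if_pos rfl, coeff_zero] at this
  exact mem_support_iff.1 hd this

theorem HasTop.component_eq {σ : Type*} {w : σ → ℤ} {N : ℤ} {P Q : MvPolynomial σ ℂ}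
    (h : HasTop w N P Q) : weightedHomogeneousComponent w N P = Q :=
  MvPolynomial.funext fun pt => tendsto_nhds_unique (h.weightLE.hasTop pt) (h pt)

theorem HasTop.weightLE_of_zero {σ : Type*} {w : σ → ℤ} {N : ℤ} {P : MvPolynomial σ ℂ}
    (h : HasTop w N P 0) : WeightLE w (N - 1) P := by
  classical
  intro d hd
  have h1 := h.weightLE d hd
  have h2 := congrArg (coeff d) h.component_eq
  rw [coeff_weightedHomogeneousComponent, coeff_zero] at h2
  have : Finsupp.weight w d ≠ N := fun h3 => mem_support_iff.1 hd (by rwa [if_pos h3] at h2)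
  omega

theorem HasTop.mul {σ : Type*} {w : σ → ℤ} {N₁ N₂ : ℤ} {P₁ P₂ Q₁ Q₂ : MvPolynomial σ ℂ}
    (h₁ : HasTop w N₁ P₁ Q₁) (h₂ : HasTop w N₂ P₂ Q₂) :
    HasTop w (N₁ + N₂) (P₁ * P₂) (Q₁ * Q₂) := by
  intro pt
  rw [map_mul]
  refine ((h₁ pt).mul (h₂ pt)).congr fun i => ?_
  rw [neg_add, zpow_add₀ (Units.ne_zero _), map_mul]
  ring

theorem HasTop.sub {σ : Type*} {w : σ → ℤ} {N : ℤ} {P₁ P₂ Q₁ Q₂ : MvPolynomial σ ℂ}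
    (h₁ : HasTop w N P₁ Q₁) (h₂ : HasTop w N P₂ Q₂) : HasTop w N (P₁ - P₂) (Q₁ - Q₂) := by
  intro pt
  rw [map_sub]
  refine ((h₁ pt).sub (h₂ pt)).congr fun i => ?_
  rw [map_sub]
  ring

theorem HasTop.add {σ : Type*} {w : σ → ℤ} {N : ℤ} {P₁ P₂ Q₁ Q₂ : MvPolynomial σ ℂ}
    (h₁ : HasTop w N P₁ Q₁) (h₂ : HasTop w N P₂ Q₂) : HasTop w N (P₁ + P₂) (Q₁ + Q₂) := by
  intro pt
  rw [map_add]
  refine ((h₁ pt).add (h₂ pt)).congr fun i => ?_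
  rw [map_add]
  ring

theorem HasTop.smul {σ : Type*} {w : σ → ℤ} {N : ℤ} {P Q : MvPolynomial σ ℂ} (c : ℂ)
    (h : HasTop w N P Q) : HasTop w N (c • P) (c • Q) := by
  intro pt
  rw [smul_eval]
  refine ((h pt).const_mul c).congr fun i => ?_
  rw [smul_eval]
  ring

theorem HasTop.zero {σ : Type*} (w : σ → ℤ) (N : ℤ) : HasTop w N 0 0 := by
  intro pt
  simp

theorem exists_weightLE {σ : Type*} (w : σ → ℤ) (P : MvPolynomial σ ℂ) :
    ∃ N : ℕ, WeightLE w N P := by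
  refine ⟨∑ d ∈ P.support, (Finsupp.weight w d).toNat, fun d hd => ?_⟩
  have := Finset.single_le_sum (f := fun d => (Finsupp.weight w d).toNat)
    (fun _ _ => Nat.zero_le _) hd
  have h2 := Int.self_le_toNat (Finsupp.weight w d)
  exact (h2.trans (by exact_mod_cast this))

theorem exists_finset_sum_component {σ : Type*} (w : σ → ℤ) (P : MvPolynomial σ ℂ) :
    ∃ S : Finset ℤ, P = ∑ l ∈ S, weightedHomogeneousComponent w l P := by
  classical
  refine ⟨P.support.image (Finsupp.weight w), ?_⟩
  ext d
  simp only [coeff_sum, coeff_weightedHomogeneousComponent, Finset.sum_ite_eq]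
  split_ifs with h
  · rfl
  · by_contra hd
    exact h (Finset.mem_image_of_mem _ (mem_support_iff.2 hd))

/-- If `Q` lies in the span of weighted homogeneous elements and is itself weighted homogeneous,
it lies in the span of those of the same weight. -/
theorem mem_span_of_isWeightedHomogeneous {σ κ : Type*} {w : σ → ℤ} {l : ℤ}
    {Q : MvPolynomial σ ℂ} (hQ : Q.IsWeightedHomogeneous w l) {S : Set κ}
    {G : κ → MvPolynomial σ ℂ} {ω : κ → ℤ}
    (hG : ∀ k ∈ S, (G k).IsWeightedHomogeneous w (ω k))
    (hmem : Q ∈ Submodule.span ℂ (G '' S)) :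
    Q ∈ Submodule.span ℂ (G '' {k ∈ S | ω k = l}) := by
  classical
  have h1 : weightedHomogeneousComponent w l Q = Q :=
    weightedHomogeneousComponent_eq_self hQ
  rw [← h1]
  have h2 := Submodule.mem_map_of_mem (f := weightedHomogeneousComponent (R := ℂ) w l) hmem
  rw [Submodule.map_span] at h2
  refine Submodule.span_le.2 ?_ h2
  rintro _ ⟨_, ⟨k, hk, rfl⟩, rfl⟩
  by_cases hkl : ω k = l
  · have := hG k hk
    rw [hkl] at this
    rw [this.weightedHomogeneousComponent_same]
    exact Submodule.subset_span ⟨k, ⟨hk, hkl⟩, rfl⟩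
  · rw [(hG k hk).weightedHomogeneousComponent_ne l (Ne.symm hkl)]
    exact Submodule.zero_mem _

/-- A polynomial in functions from a subalgebra of functions stays in the subalgebra. -/
theorem eval_mem_subalgebra {T σ : Type*} (S : Subalgebra ℂ (T → ℂ)) {φ : T → σ → ℂ}
    (hφ : ∀ c, (fun t => φ t c) ∈ S) (P : MvPolynomial σ ℂ) : (fun t => eval (φ t) P) ∈ S := by
  induction P using MvPolynomial.induction_on with
  | C a =>
    simp only [eval_C]
    exact S.algebraMap_mem a
  | add p q hp hq =>
    simp only [map_add]
    exact S.add_mem hp hq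
  | mul_X p c hp =>
    simp only [map_mul, eval_X]
    exact S.mul_mem hp (hφ c)

end GordanCov

namespace GordanCov

theorem eval_sumElim {σ τ : Type*} (Q : MvPolynomial (σ ⊕ τ) ℂ) (p : σ → ℂ) (q : τ → ℂ) :
    eval (Sum.elim p q) Q = eval p (map (eval q) (sumAlgEquiv ℂ σ τ Q)) := by
  induction Q using MvPolynomial.induction_on with
  | C a => simp
  | add P Q hP hQ => simp only [map_add, hP, hQ]
  | mul_X P c hP =>
    rw [map_mul, map_mul, map_mul, map_mul, hP]
    rcases c with c | c <;> simp

/-- A polynomial in two groups of variables which is invariant under transformations of each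
group is a sum of products of invariants. -/
theorem mem_span_mul_of_invariant {σ τ ι κ : Type*} (Q : MvPolynomial (σ ⊕ τ) ℂ)
    (γ : ι → (σ → ℂ) → (σ → ℂ)) (δ : κ → (τ → ℂ) → (τ → ℂ))
    (hγ : ∀ i p q, eval (Sum.elim (γ i p) q) Q = eval (Sum.elim p q) Q)
    (hδ : ∀ k p q, eval (Sum.elim p (δ k q)) Q = eval (Sum.elim p q) Q) :
    Q ∈ Submodule.span ℂ
      ((fun ab : MvPolynomial σ ℂ × MvPolynomial τ ℂ => rename Sum.inl ab.1 * rename Sum.inr ab.2) ''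
        {ab | (∀ i p, eval (γ i p) ab.1 = eval p ab.1) ∧
          ∀ k q, eval (δ k q) ab.2 = eval q ab.2}) := by
  classical
  set R := sumAlgEquiv ℂ σ τ Q with hR
  have hb : ∀ μ k q, eval (δ k q) (coeff μ R) = eval q (coeff μ R) := by
    intro μ k q
    have h1 : map (eval (δ k q)) R = map (eval q) R := MvPolynomial.funext fun p => by
      rw [← eval_sumElim, ← eval_sumElim, hδ]
    simpa only [coeff_map] using congrArg (coeff μ) h1
  let B' : Submodule ℂ (MvPolynomial τ ℂ) :=
    { carrier := {b | ∀ k q, eval (δ k q) b = eval q b}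
      add_mem' := fun {x y} hx hy k q => by rw [map_add, map_add, hx, hy]
      zero_mem' := fun k q => by rw [map_zero, map_zero]
      smul_mem' := fun c x hx k q => by rw [smul_eval, smul_eval, hx] }
  let β := Module.Basis.ofVectorSpace ℂ B'
  let b : (σ →₀ ℕ) → B' := fun μ => ⟨coeff μ R, hb μ⟩
  let I₀ := R.support.biUnion fun μ => (β.repr (b μ)).support
  let a : Module.Basis.ofVectorSpaceIndex ℂ B' → MvPolynomial σ ℂ := fun i =>
    ∑ μ ∈ R.support, monomial μ (β.repr (b μ) i)
  have hrepr : ∀ μ ∈ R.support, coeff μ R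
      = ∑ i ∈ I₀, β.repr (b μ) i • (β i : MvPolynomial τ ℂ) := by
    intro μ hμ
    have h1 := congrArg Subtype.val (β.linearCombination_repr (b μ))
    rw [Finsupp.linearCombination_apply, Finsupp.sum_of_support_subset (s := I₀) _
      (Finset.subset_biUnion_of_mem (fun μ => (β.repr (b μ)).support) hμ) _ (by simp)] at h1
    simpa [b] using h1.symm
  have heval : ∀ p q, eval (Sum.elim p q) Q
      = ∑ i ∈ I₀, eval p (a i) * eval q (β i : MvPolynomial τ ℂ) := by
    intro p q
    rw [eval_sumElim, eval_map, eval₂_eq]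
    have h1 : ∀ μ ∈ R.support, eval q (coeff μ R) * ∏ i ∈ μ.support, p i ^ μ i
        = ∑ i ∈ I₀, eval p (monomial μ (β.repr (b μ) i)) * eval q (β i : MvPolynomial τ ℂ) := by
      intro μ hμ
      rw [hrepr μ hμ, map_sum, Finset.sum_mul]
      refine Finset.sum_congr rfl fun i _ => ?_
      rw [smul_eval, eval_monomial, Finsupp.prod]
      ring
    rw [Finset.sum_congr rfl h1, Finset.sum_comm]
    refine Finset.sum_congr rfl fun i _ => ?_
    rw [map_sum, Finset.sum_mul]
  have ha : ∀ i ∈ I₀, ∀ j p, eval (γ j p) (a i) = eval p (a i) := by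
    intro i hi j p
    have h1 : ∑ i ∈ I₀, (eval (γ j p) (a i) - eval p (a i)) • β i = 0 := by
      refine Subtype.ext (MvPolynomial.funext fun q => ?_)
      have h2 := hγ j p q
      rw [heval, heval, ← sub_eq_zero, ← Finset.sum_sub_distrib] at h2
      simp only [Submodule.coe_sum, Submodule.coe_smul, map_sum, smul_eval, Submodule.coe_zero,
        map_zero]
      rw [← h2]
      refine Finset.sum_congr rfl fun i _ => ?_
      ring
    exact sub_eq_zero.1 (linearIndependent_iff'.1 β.linearIndependent I₀ _ h1 i hi)
  have hQ : Q = ∑ i ∈ I₀, rename Sum.inl (a i) * rename Sum.inr (β i : MvPolynomial τ ℂ) := by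
    refine MvPolynomial.funext fun pt => ?_
    have h1 := heval (pt ∘ Sum.inl) (pt ∘ Sum.inr)
    rw [Sum.elim_comp_inl_inr] at h1
    rw [h1, map_sum]
    refine Finset.sum_congr rfl fun i _ => ?_
    rw [map_mul, eval_rename, eval_rename]
  rw [hQ]
  exact Submodule.sum_mem _ fun i hi =>
    Submodule.subset_span ⟨(a i, β i), ⟨ha i hi, (β i).2⟩, rfl⟩

end GordanCov

namespace GordanCov

open Filter Topology

/-- The exponent of `x ^ (n - i) * y ^ i`. -/
def formExp (n : ℕ) (i : Fin (n + 1)) : Fin 2 →₀ ℕ :=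
  Finsupp.single 0 (n - (i : ℕ)) + Finsupp.single 1 (i : ℕ)

theorem formExp_injective (n : ℕ) : Function.Injective (formExp n) := by
  intro i j h
  have := DFunLike.congr_fun h 1
  simp only [formExp, Finsupp.add_apply, Finsupp.single_apply] at this
  simpa [Fin.ext_iff] using this

theorem C_mul_X_pow_mul_X_pow {R : Type*} [CommSemiring R] (a : R) (k l : ℕ) :
    (C a * X 0 ^ k * X 1 ^ l : MvPolynomial (Fin 2) R)
      = monomial (Finsupp.single 0 k + Finsupp.single 1 l) a := by
  rw [X_pow_eq_monomial, X_pow_eq_monomial, C_mul_monomial, monomial_mul]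
  simp

theorem form_eq_sum (n : ℕ) (a : Fin (n + 1) → ℂ) :
    form n a = ∑ i, monomial (formExp n i) (a i) :=
  Finset.sum_congr rfl fun _ _ => C_mul_X_pow_mul_X_pow _ _ _

theorem coeffOf_form (n : ℕ) (a : Fin (n + 1) → ℂ) : coeffOf n (form n a) = a := by
  classical
  funext i
  change coeff (formExp n i) _ = _
  rw [form_eq_sum, coeff_sum, Finset.sum_eq_single i]
  · simp
  · intro j _ hj
    rw [coeff_monomial, if_neg fun h => hj (formExp_injective n h)]
  · simp

theorem form_coeffOf {n : ℕ} {p : MvPolynomial (Fin 2) ℂ} (hp : p.IsHomogeneous n) :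
    form n (coeffOf n p) = p := by
  classical
  ext d
  rw [form_eq_sum, coeff_sum]
  by_cases hd : d 0 + d 1 = n
  · have hdi : formExp n ⟨d 1, by omega⟩ = d := by
      ext k
      fin_cases k <;> (simp [formExp]; try omega)
    rw [Finset.sum_eq_single ⟨d 1, by omega⟩]
    · rw [hdi, coeff_monomial, if_pos rfl]
      change coeff (formExp n _) p = _
      rw [hdi]
    · intro j _ hj
      rw [coeff_monomial, if_neg]
      rintro h
      exact hj (formExp_injective n (h.trans hdi.symm))
    · simp
  · rw [Finset.sum_eq_zero, eq_comm]
    · by_contra h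
      have h1 := hp h
      rw [Finsupp.weight_apply, Finsupp.sum_fintype _ _ (by simp)] at h1
      simp at h1
      omega
    · intro j _
      rw [coeff_monomial, if_neg]
      rintro rfl
      apply hd
      have := j.2
      simp [formExp]
      omega

theorem isHomogeneous_form (n : ℕ) (a : Fin (n + 1) → ℂ) : (form n a).IsHomogeneous n := by
  refine IsHomogeneous.sum _ _ _ fun i _ => ?_
  have h := ((isHomogeneous_C (Fin 2) (a i)).mul (isHomogeneous_X_pow 0 (n - (i : ℕ)))).mul
    (isHomogeneous_X_pow (R := ℂ) 1 (i : ℕ))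
  have := i.2
  rwa [show 0 + (n - (i : ℕ)) + i = n by omega] at h

theorem isHomogeneous_subst2 (g : SL2) {n : ℕ} {p : MvPolynomial (Fin 2) ℂ}
    (hp : p.IsHomogeneous n) : (subst2 g p).IsHomogeneous n := by
  have := hp.aeval (n := 1) (fun i => ∑ j : Fin 2, C ((g⁻¹).1 i j) * (X j : MvPolynomial (Fin 2) ℂ))
    fun i => IsHomogeneous.sum _ _ _ fun j _ => by
      simpa using (isHomogeneous_C (Fin 2) ((g⁻¹).1 i j)).mul (isHomogeneous_X ℂ j)
  simpa [subst2] using this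

theorem eval_subst2 (g : SL2) (p : MvPolynomial (Fin 2) ℂ) (x : Fin 2 → ℂ) :
    eval x (subst2 g p) = eval (fun i => ∑ j : Fin 2, (g⁻¹).1 i j * x j) p := by
  induction p using MvPolynomial.induction_on with
  | C a => simp [subst2]
  | add p q hp hq => rw [map_add, map_add, map_add, hp, hq]
  | mul_X p c hp =>
    rw [map_mul, map_mul, map_mul, hp]
    simp [subst2]

theorem subst2_mul (g h : SL2) (p : MvPolynomial (Fin 2) ℂ) :
    subst2 (g * h) p = subst2 g (subst2 h p) := by
  refine MvPolynomial.funext fun x => ?_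
  rw [eval_subst2, eval_subst2, eval_subst2, mul_inv_rev]
  congr 2
  funext i
  simp only [Matrix.SpecialLinearGroup.coe_mul, Matrix.mul_apply, Fin.sum_univ_two]
  ring

theorem subst2_one (p : MvPolynomial (Fin 2) ℂ) : subst2 1 p = p := by
  refine MvPolynomial.funext fun x => ?_
  rw [eval_subst2]
  congr 2
  funext i
  fin_cases i <;> simp

theorem form_coeffAct (g : SL2) (n : ℕ) (a : Fin (n + 1) → ℂ) :
    form n (coeffAct g n a) = subst2 g (form n a) :=
  form_coeffOf (isHomogeneous_subst2 g (isHomogeneous_form n a))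

theorem coeffAct_mul (g h : SL2) (n : ℕ) (a : Fin (n + 1) → ℂ) :
    coeffAct g n (coeffAct h n a) = coeffAct (g * h) n a := by
  rw [coeffAct, form_coeffAct, ← subst2_mul, coeffAct]

theorem coeffAct_one (n : ℕ) (a : Fin (n + 1) → ℂ) : coeffAct 1 n a = a := by
  rw [coeffAct, subst2_one, coeffOf_form]

/-- The matrix entries of the action on forms of degree `n`, as polynomials in the entries of
the substitution matrix. -/
def actEntry (n : ℕ) (i j : Fin (n + 1)) : MvPolynomial (Fin 2 × Fin 2) ℂ :=
  coeff (formExp n i)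
    ((∑ k : Fin 2, C (X (0, k)) * X k) ^ (n - (j : ℕ)) * (∑ k : Fin 2, C (X (1, k)) * X k) ^ (j : ℕ))

theorem coeffAct_eq_sum (g : SL2) (n : ℕ) (a : Fin (n + 1) → ℂ) (i : Fin (n + 1)) :
    coeffAct g n a i = ∑ j, a j * eval (fun p => (g⁻¹).1 p.1 p.2) (actEntry n i j) := by
  change coeff (formExp n i) _ = _
  rw [form, map_sum, coeff_sum]
  refine Finset.sum_congr rfl fun j _ => ?_
  rw [actEntry, ← coeff_map, map_mul, map_mul, mul_assoc, subst2, algHom_C, algebraMap_eq,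
    coeff_C_mul]
  congr 2
  simp

theorem inv_entries (g : SL2) : (g⁻¹).1 = !![g.1 1 1, -g.1 0 1; -g.1 1 0, g.1 0 0] := by
  rw [Matrix.SpecialLinearGroup.coe_inv, Matrix.adjugate_fin_two]

theorem coeffAct_mem {T : Type*} (S : Subalgebra ℂ (T → ℂ)) {g : T → SL2}
    (hg : ∀ i j, (fun t => (g t).1 i j) ∈ S) (n : ℕ) {a : T → Fin (n + 1) → ℂ}
    (ha : ∀ j, (fun t => a t j) ∈ S) (i : Fin (n + 1)) :
    (fun t => coeffAct (g t) n (a t) i) ∈ S := by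
  have h1 : (fun t => coeffAct (g t) n (a t) i)
      = ∑ j, (fun t => a t j) * fun t => eval (fun p => ((g t)⁻¹).1 p.1 p.2) (actEntry n i j) := by
    funext t
    rw [coeffAct_eq_sum]
    simp
  rw [h1]
  refine S.sum_mem fun j _ => S.mul_mem (ha j) (eval_mem_subalgebra S ?_ _)
  rintro ⟨k, l⟩
  simp only [inv_entries]
  fin_cases k <;> fin_cases l <;> simp only [Fin.zero_eta, Fin.mk_one, Fin.isValue, Matrix.of_apply,
    Matrix.cons_val', Matrix.cons_val_zero, Matrix.cons_val_one, Matrix.cons_val_fin_one]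
  · exact hg 1 1
  · exact S.neg_mem (hg 0 1)
  · exact S.neg_mem (hg 1 0)
  · exact hg 0 0

/-- The diagonal torus of `SL(2,ℂ)`. -/
def tau (s : ℂˣ) : SL2 := ⟨!![(s : ℂ), 0; 0, (s : ℂ)⁻¹], by simp [Matrix.det_fin_two]⟩

/-- The upper triangular unipotent subgroup of `SL(2,ℂ)`. -/
def upper (t : ℂ) : SL2 := ⟨!![1, t; 0, 1], by simp [Matrix.det_fin_two]⟩

/-- The lower triangular unipotent subgroup of `SL(2,ℂ)`. -/
def lower (t : ℂ) : SL2 := ⟨!![1, 0; t, 1], by simp [Matrix.det_fin_two]⟩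

theorem sl2_ext {g h : SL2} (h00 : g.1 0 0 = h.1 0 0) (h01 : g.1 0 1 = h.1 0 1)
    (h10 : g.1 1 0 = h.1 1 0) (h11 : g.1 1 1 = h.1 1 1) : g = h := by
  refine Subtype.ext ?_
  ext i j
  fin_cases i <;> fin_cases j <;> assumption

theorem mul_entry (g h : SL2) (i j : Fin 2) :
    (g * h).1 i j = g.1 i 0 * h.1 0 j + g.1 i 1 * h.1 1 j := by
  change (g.1 * h.1) i j = _
  rw [Matrix.mul_apply, Fin.sum_univ_two]

theorem tau_mul_tau (s t : ℂˣ) : tau s * tau t = tau (s * t) := by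
  apply sl2_ext <;> simp only [mul_entry] <;> simp [tau, mul_comm]

theorem tau_one : tau 1 = 1 := by
  apply sl2_ext <;> simp [tau]

theorem tau_mul_tau_inv (s : ℂˣ) : tau s * tau s⁻¹ = 1 := by
  rw [tau_mul_tau, mul_inv_cancel, tau_one]

theorem tau_inv_mul_tau (s : ℂˣ) : tau s⁻¹ * tau s = 1 := by
  rw [tau_mul_tau, inv_mul_cancel, tau_one]

theorem tau_mul_lower (s : ℂˣ) (t : ℂ) :
    tau s * lower t = lower ((s : ℂ)⁻¹ * (s : ℂ)⁻¹ * t) * tau s := by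
  have := s.ne_zero
  apply sl2_ext <;> simp only [mul_entry] <;> simp [tau, lower]
  field_simp

theorem tau_mul_upper (s : ℂˣ) (t : ℂ) :
    tau s * upper t = upper ((s : ℂ) * (s : ℂ) * t) * tau s := by
  have := s.ne_zero
  apply sl2_ext <;> simp only [mul_entry] <;> simp [tau, upper]
  field_simp

theorem lower_mul_lower (t t' : ℂ) : lower t * lower t' = lower (t + t') := by
  apply sl2_ext <;> simp only [mul_entry] <;> simp [lower]

theorem upper_mul_upper (t t' : ℂ) : upper t * upper t' = upper (t + t') := by
  apply sl2_ext <;> simp only [mul_entry] <;> simp [upper, add_comm]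

theorem lower_zero : lower 0 = 1 := by
  apply sl2_ext <;> simp [lower]

theorem upper_zero : upper 0 = 1 := by
  apply sl2_ext <;> simp [upper]

theorem coeffAct_tau (s : ℂˣ) (n : ℕ) (a : Fin (n + 1) → ℂ) (j : Fin (n + 1)) :
    coeffAct (tau s) n a j = (s : ℂ) ^ (2 * (j : ℤ) - n) * a j := by
  have hs := s.ne_zero
  have h1 : subst2 (tau s) (form n a) = form n fun j => (s : ℂ) ^ (2 * (j : ℤ) - n) * a j := by
    refine MvPolynomial.funext fun x => ?_
    rw [eval_subst2, inv_entries]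
    simp only [form, map_sum, map_mul, map_pow, eval_C, eval_X, tau, Fin.sum_univ_two]
    refine Finset.sum_congr rfl fun i _ => ?_
    simp only [Matrix.of_apply, Matrix.cons_val', Matrix.cons_val_zero, Matrix.cons_val_one,
      Matrix.cons_val_fin_one, neg_zero, zero_mul, add_zero, zero_add, mul_pow]
    have hi := i.2
    have h2 : (s : ℂ) ^ (2 * (i : ℤ) - n) = (s : ℂ)⁻¹ ^ (n - (i : ℕ)) * (s : ℂ) ^ (i : ℕ) := by
      rw [inv_pow, ← zpow_natCast, ← zpow_natCast, ← zpow_neg, ← zpow_add₀ hs]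
      congr 1
      push_cast [Nat.le_of_lt_succ hi]
      ring
    rw [h2]
    ring
  rw [coeffAct, h1, coeffOf_form]

/-- Action of a family of group elements, one for each summand of `V`, and one for `ℂ²`. -/
def actFam {ι : Type} (ν : ι → ℕ) (γ : ι → SL2) (h : SL2) (pt : Var ν → ℂ) : Var ν → ℂ :=
  Sum.elim
    (fun c => coeffAct (γ c.1) (ν c.1) (fun k => pt (Sum.inl ⟨c.1, k⟩)) c.2)
    (fun i => ∑ j : Fin 2, h.1 i j * pt (Sum.inr j))

theorem actFam_mul {ι : Type} (ν : ι → ℕ) (γ γ' : ι → SL2) (h h' : SL2) (pt : Var ν → ℂ) :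
    actFam ν γ h (actFam ν γ' h' pt) = actFam ν (γ * γ') (h * h') pt := by
  funext c
  rcases c with c | i
  · simp only [actFam, Sum.elim_inl, Pi.mul_apply]
    rw [← coeffAct_mul]
  · simp only [actFam, Sum.elim_inr, Matrix.SpecialLinearGroup.coe_mul, Matrix.mul_apply,
      Fin.sum_univ_two]
    ring

theorem actFam_one {ι : Type} (ν : ι → ℕ) (pt : Var ν → ℂ) : actFam ν 1 1 pt = pt := by
  funext c
  rcases c with c | i
  · simp only [actFam, Sum.elim_inl, Pi.one_apply, coeffAct_one]
  · fin_cases i <;> simp [actFam]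

theorem actFam_mem {T : Type*} (S : Subalgebra ℂ (T → ℂ)) {ι : Type} (ν : ι → ℕ)
    {γ : T → ι → SL2} {h : T → SL2} {pt : T → Var ν → ℂ}
    (hγ : ∀ k i j, (fun t => (γ t k).1 i j) ∈ S) (hh : ∀ i j, (fun t => (h t).1 i j) ∈ S)
    (hpt : ∀ c, (fun t => pt t c) ∈ S) (c : Var ν) :
    (fun t => actFam ν (γ t) (h t) (pt t) c) ∈ S := by
  rcases c with c | i
  · exact coeffAct_mem S (hγ c.1) (ν c.1) (fun j => hpt _) c.2
  · simp only [actFam, Sum.elim_inr, Fin.sum_univ_two]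
    exact S.add_mem (S.mul_mem (hh i 0) (hpt _)) (S.mul_mem (hh i 1) (hpt _))

theorem ptAct_eq_actFam {ι : Type} (ν : ι → ℕ) (g : SL2) (pt : Var ν → ℂ) :
    ptAct ν g pt = actFam ν (fun _ => g) g pt := rfl

end GordanCov

namespace GordanCov

open Filter Topology

/-- Specialise the coefficients of the forms to `v` and substitute `M x` for `x`. -/
def spec {ι : Type} (ν : ι → ℕ) (v : (Σ i : ι, Fin (ν i + 1)) → ℂ) (M : Matrix (Fin 2) (Fin 2) ℂ) :
    CoordRing ν →ₐ[ℂ] CoordRing ν :=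
  aeval (Sum.elim (fun c => C (v c)) fun i => ∑ j, C (M i j) * X (Sum.inr j))

/-- The analogue of `spec` with three pairs of variables. -/
def specT {ι : Type} (ν : ι → ℕ) (v : (Σ i : ι, Fin (ν i + 1)) → ℂ) (M : Matrix (Fin 2) (Fin 2) ℂ) :
    TRing ν →ₐ[ℂ] TRing ν :=
  aeval (Sum.elim (fun c => C (v c)) fun a => ∑ j, C (M a.2 j) * X (Sum.inr (a.1, j)))

theorem eval_spec {ι : Type} (ν : ι → ℕ) (v : (Σ i : ι, Fin (ν i + 1)) → ℂ)
    (M : Matrix (Fin 2) (Fin 2) ℂ) (pt : Var ν → ℂ) (P : CoordRing ν) :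
    eval pt (spec ν v M P)
      = eval (Sum.elim v fun i => ∑ j, M i j * pt (Sum.inr j)) P := by
  induction P using MvPolynomial.induction_on with
  | C a => simp [spec]
  | add p q hp hq => rw [map_add, map_add, map_add, hp, hq]
  | mul_X p c hp =>
    rw [map_mul, map_mul, map_mul, hp]
    rcases c with c | c <;> simp [spec]

theorem embT_spec {ι : Type} (ν : ι → ℕ) (v : (Σ i : ι, Fin (ν i + 1)) → ℂ)
    (M : Matrix (Fin 2) (Fin 2) ℂ) (a : Fin 3) (P : CoordRing ν) :
    embT ν a (spec ν v M P) = specT ν v M (embT ν a P) := by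
  change ((embT ν a).comp (spec ν v M)) P = ((specT ν v M).comp (embT ν a)) P
  congr 1
  ext c
  rcases c with c | c <;> simp [embT, spec, specT]

theorem collapseT_specT {ι : Type} (ν : ι → ℕ) (v : (Σ i : ι, Fin (ν i + 1)) → ℂ)
    (M : Matrix (Fin 2) (Fin 2) ℂ) (P : TRing ν) :
    collapseT ν (specT ν v M P) = spec ν v M (collapseT ν P) := by
  change ((collapseT ν).comp (specT ν v M)) P = ((spec ν v M).comp (collapseT ν)) P
  congr 1
  ext c
  rcases c with c | c <;> simp [collapseT, spec, specT]

theorem pdT_specT {ι : Type} (ν : ι → ℕ) (v : (Σ i : ι, Fin (ν i + 1)) → ℂ)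
    (M : Matrix (Fin 2) (Fin 2) ℂ) (a : Fin 3) (i : Fin 2) (P : TRing ν) :
    pdT ν (a, i) (specT ν v M P) = ∑ k, C (M k i) * specT ν v M (pdT ν (a, k) P) := by
  classical
  simp only [pdT, Derivation.coeFn_coe]
  induction P using MvPolynomial.induction_on with
  | C a => simp [specT]
  | add p q hp hq => simp only [map_add, hp, hq, mul_add, Finset.sum_add_distrib]
  | mul_X p c hp =>
    simp only [map_mul, Derivation.leibniz, hp, smul_eq_mul, map_add, Fin.sum_univ_two]
    rcases c with c | ⟨b, c⟩
    · simp [specT, pderiv_X]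
      ring
    · by_cases hb : b = a
      · subst hb
        fin_cases c <;> fin_cases i <;> simp [specT, pderiv_X] <;> ring
      · simp [specT, pderiv_X, hb]
        ring

theorem SigmaT_specT {ι : Type} (ν : ι → ℕ) (v : (Σ i : ι, Fin (ν i + 1)) → ℂ)
    (M : Matrix (Fin 2) (Fin 2) ℂ) (a : Fin 3) (P : TRing ν) :
    SigmaT ν a (specT ν v M P) = specT ν v M (SigmaT ν a P) := by
  have h : ∀ i, specT ν v M (X (Sum.inr (0, i)))
      = C (M i 0) * X (Sum.inr (0, 0)) + C (M i 1) * X (Sum.inr (0, 1)) := by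
    intro i
    simp [specT]
  simp only [SigmaT, LinearMap.add_apply, Module.End.mul_apply, LinearMap.mulLeft_apply, pdT_specT,
    Fin.sum_univ_two, map_add, map_mul, h]
  ring

theorem OmegaT_specT {ι : Type} (ν : ι → ℕ) (v : (Σ i : ι, Fin (ν i + 1)) → ℂ)
    (M : Matrix (Fin 2) (Fin 2) ℂ) (a b : Fin 3) (P : TRing ν) :
    OmegaT ν a b (specT ν v M P) = M.det • specT ν v M (OmegaT ν a b P) := by
  have hC : ∀ (v : Fin 3 × Fin 2) (c : ℂ) (Q : TRing ν), pdT ν v (C c * Q) = C c * pdT ν v Q := by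
    intro v c Q
    rw [← smul_eq_C_mul, ← smul_eq_C_mul, map_smul]
  simp only [OmegaT, LinearMap.sub_apply, Module.End.mul_apply, pdT_specT,
    Fin.sum_univ_two, map_add, map_sub, hC, Matrix.det_fin_two, smul_eq_C_mul]
  simp only [map_mul]
  ring

theorem SigmaT_pow_specT {ι : Type} (ν : ι → ℕ) (v : (Σ i : ι, Fin (ν i + 1)) → ℂ)
    (M : Matrix (Fin 2) (Fin 2) ℂ) (a : Fin 3) (k : ℕ) (P : TRing ν) :
    (SigmaT ν a ^ k) (specT ν v M P) = specT ν v M ((SigmaT ν a ^ k) P) := by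
  induction k generalizing P with
  | zero => simp
  | succ k ih => rw [pow_succ, Module.End.mul_apply, Module.End.mul_apply, SigmaT_specT, ih]

theorem OmegaT_pow_specT {ι : Type} (ν : ι → ℕ) (v : (Σ i : ι, Fin (ν i + 1)) → ℂ)
    (M : Matrix (Fin 2) (Fin 2) ℂ) (a b : Fin 3) (k : ℕ) (P : TRing ν) :
    (OmegaT ν a b ^ k) (specT ν v M P) = M.det ^ k • specT ν v M ((OmegaT ν a b ^ k) P) := by
  induction k generalizing P with
  | zero => simp
  | succ k ih =>
    rw [pow_succ, Module.End.mul_apply, Module.End.mul_apply, OmegaT_specT, map_smul, ih, smul_smul,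
      pow_succ, mul_comm]

theorem transvect_spec {ι : Type} (ν : ι → ℕ) (v : (Σ i : ι, Fin (ν i + 1)) → ℂ)
    (M : Matrix (Fin 2) (Fin 2) ℂ) (k l r : ℕ) (U W : CoordRing ν) :
    transvect ν k l r (spec ν v M U) (spec ν v M W)
      = M.det ^ r • spec ν v M (transvect ν k l r U W) := by
  rw [transvect, transvect]
  split_ifs
  · rw [embT_spec, embT_spec, ← map_mul, SigmaT_pow_specT, SigmaT_pow_specT, OmegaT_pow_specT,
      map_smul, collapseT_specT]
  · simp

/-- The transvectant as a bilinear map. -/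
def transvectBilin {ι : Type} (ν : ι → ℕ) (k l r : ℕ) :
    CoordRing ν →ₗ[ℂ] CoordRing ν →ₗ[ℂ] CoordRing ν :=
  if r ≤ min k l then
    ((LinearMap.mul ℂ (TRing ν)).compl₁₂ (embT ν 1).toLinearMap (embT ν 2).toLinearMap).compr₂
      ((collapseT ν).toLinearMap ∘ₗ (OmegaT ν 1 2 ^ r) ∘ₗ (SigmaT ν 1 ^ (k - r)) ∘ₗ
        (SigmaT ν 2 ^ (l - r)))
  else 0

theorem transvectBilin_apply {ι : Type} (ν : ι → ℕ) (k l r : ℕ) (U W : CoordRing ν) :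
    transvectBilin ν k l r U W = transvect ν k l r U W := by
  rw [transvect, transvectBilin]
  split_ifs <;> rfl

theorem transvect_one_one {ι : Type} (ν : ι → ℕ) : transvect ν 0 0 0 1 1 = 1 := by
  simp [transvect]

end GordanCov

namespace GordanCov

open Filter Topology

/-- The monomials which occur when computing `⟨y ^ k, x ^ l⟩_r`. -/
def monoT {ι : Type} (ν : ι → ℕ) (i j k l : ℕ) : TRing ν :=
  X (Sum.inr (0, 0)) ^ i * X (Sum.inr (0, 1)) ^ j * X (Sum.inr (1, 1)) ^ k
    * X (Sum.inr (2, 0)) ^ l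

theorem SigmaT_one_monoT {ι : Type} (ν : ι → ℕ) (i j k l : ℕ) :
    SigmaT ν 1 (monoT ν i j (k + 1) l) = (k + 1 : ℂ) • monoT ν i (j + 1) k l := by
  classical
  simp [SigmaT, monoT, pdT, pderiv_X, smul_eq_C_mul, Derivation.leibniz_pow]
  ring

theorem SigmaT_two_monoT {ι : Type} (ν : ι → ℕ) (i j k l : ℕ) :
    SigmaT ν 2 (monoT ν i j k (l + 1)) = (l + 1 : ℂ) • monoT ν (i + 1) j k l := by
  classical
  simp [SigmaT, monoT, pdT, pderiv_X, smul_eq_C_mul, Derivation.leibniz_pow]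
  ring

theorem OmegaT_monoT {ι : Type} (ν : ι → ℕ) (i j k l : ℕ) :
    OmegaT ν 1 2 (monoT ν i j (k + 1) (l + 1)) = (-((k + 1) * (l + 1)) : ℂ) • monoT ν i j k l := by
  classical
  simp [OmegaT, monoT, pdT, pderiv_X, smul_eq_C_mul, Derivation.leibniz_pow]
  ring

theorem exists_transvect_eq_smul {ι : Type} (ν : ι → ℕ) (u v r : ℕ) :
    ∃ c : ℂ, c ≠ 0 ∧ transvect ν (u + r) (v + r) r (X (Sum.inr 1) ^ (u + r))
      (X (Sum.inr 0) ^ (v + r)) = c • (X (Sum.inr 1) ^ u * X (Sum.inr 0) ^ v) := by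
  have h1 : ∀ u i j k l, ∃ c : ℂ, c ≠ 0 ∧
      (SigmaT ν 1 ^ u) (monoT ν i j (u + k) l) = c • monoT ν i (j + u) k l := by
    intro u
    induction u with
    | zero => exact fun i j k l => ⟨1, one_ne_zero, by simp⟩
    | succ u ih =>
      intro i j k l
      obtain ⟨c, hc, h⟩ := ih i (j + 1) k l
      refine ⟨(u + k + 1) * c, mul_ne_zero (by exact_mod_cast (u + k).succ_ne_zero) hc, ?_⟩
      rw [pow_succ, Module.End.mul_apply, show u + 1 + k = u + k + 1 by ring, SigmaT_one_monoT,
        map_smul, h, smul_smul, show j + 1 + u = j + (u + 1) by ring]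
      push_cast
      rfl
  have h2 : ∀ u i j k l, ∃ c : ℂ, c ≠ 0 ∧
      (SigmaT ν 2 ^ u) (monoT ν i j k (u + l)) = c • monoT ν (i + u) j k l := by
    intro u
    induction u with
    | zero => exact fun i j k l => ⟨1, one_ne_zero, by simp⟩
    | succ u ih =>
      intro i j k l
      obtain ⟨c, hc, h⟩ := ih (i + 1) j k l
      refine ⟨(u + l + 1) * c, mul_ne_zero (by exact_mod_cast (u + l).succ_ne_zero) hc, ?_⟩
      rw [pow_succ, Module.End.mul_apply, show u + 1 + l = u + l + 1 by ring, SigmaT_two_monoT,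
        map_smul, h, smul_smul, show i + 1 + u = i + (u + 1) by ring]
      push_cast
      rfl
  have h3 : ∀ u i j, ∃ c : ℂ, c ≠ 0 ∧
      (OmegaT ν 1 2 ^ u) (monoT ν i j u u) = c • monoT ν i j 0 0 := by
    intro u
    induction u with
    | zero => exact fun i j => ⟨1, one_ne_zero, by simp⟩
    | succ u ih =>
      intro i j
      obtain ⟨c, hc, h⟩ := ih i j
      refine ⟨-((u + 1) * (u + 1)) * c, mul_ne_zero (neg_ne_zero.2 (mul_self_ne_zero.2
        (by exact_mod_cast u.succ_ne_zero))) hc, ?_⟩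
      rw [pow_succ, Module.End.mul_apply, OmegaT_monoT, map_smul, h, smul_smul]
  obtain ⟨c1, hc1, e1⟩ := h1 u v 0 r r
  obtain ⟨c2, hc2, e2⟩ := h2 v 0 0 (u + r) r
  obtain ⟨c3, hc3, e3⟩ := h3 r v u
  refine ⟨c2 * (c1 * c3), mul_ne_zero hc2 (mul_ne_zero hc1 hc3), ?_⟩
  have h0 : embT ν 1 (X (Sum.inr 1) ^ (u + r)) * embT ν 2 (X (Sum.inr 0) ^ (v + r))
      = monoT ν 0 0 (u + r) (v + r) := by
    simp [embT, monoT]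
  rw [transvect, if_pos (by simp), Nat.add_sub_cancel, Nat.add_sub_cancel, h0, e2, map_smul,
    zero_add, e1, map_smul, map_smul, map_smul, zero_add, e3, map_smul, map_smul, smul_smul,
    smul_smul]
  congr 1
  · ring
  · simp [monoT, collapseT, mul_comm]

/-- The weight which counts the order in `x`. -/
def ordWt {ι : Type} (ν : ι → ℕ) : Var ν → ℤ := Sum.elim (fun _ => 0) fun _ => 1

theorem eval_eq_eval_spec {ι : Type} (ν : ι → ℕ) (pt : Var ν → ℂ) (v : (Σ i : ι, Fin (ν i + 1)) → ℂ)
    (M : Matrix (Fin 2) (Fin 2) ℂ) {pt' : Var ν → ℂ} (h1 : ∀ c, pt' (Sum.inl c) = v c)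
    (h2 : ∀ i, pt' (Sum.inr i) = M i 0 * pt (Sum.inr 0) + M i 1 * pt (Sum.inr 1))
    (P : CoordRing ν) : eval pt' P = eval pt (spec ν v M P) := by
  rw [eval_spec]
  congr 2
  funext c
  rcases c with c | c
  · exact h1 c
  · rw [h2, Sum.elim_inr, Fin.sum_univ_two]

theorem eval_sumElim_eq {ι : Type} (ν : ι → ℕ) (x : Var ν → ℂ) (v : (Σ i : ι, Fin (ν i + 1)) → ℂ)
    (P : CoordRing ν) : eval (Sum.elim v fun i => x (Sum.inr i)) P = eval x (spec ν v 1 P) := by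
  rw [eval_spec]
  congr 2
  funext c
  rcases c with c | c
  · rfl
  · simp [Matrix.one_apply]

theorem transvect_mem_covariants {ι : Type} {ν : ι → ℕ} {U W : CoordRing ν}
    (hU : U ∈ Covariants ν) (hW : W ∈ Covariants ν) (k l r : ℕ) :
    transvect ν k l r U W ∈ Covariants ν := by
  intro g pt
  set v' := fun c => ptAct ν g pt (Sum.inl c)
  set v := fun c => pt (Sum.inl c)
  have key : ∀ Q ∈ Covariants ν, spec ν v' g.1 Q = spec ν v 1 Q := by
    intro Q hQ
    refine MvPolynomial.funext fun x => ?_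
    have := hQ g (Sum.elim v fun i => x (Sum.inr i))
    rw [← eval_sumElim_eq, ← this]
    symm
    apply eval_eq_eval_spec
    · intro c; rfl
    · intro i
      simp [ptAct]
  have h1 := transvect_spec ν v' g.1 k l r U W
  rw [key U hU, key W hW, transvect_spec, g.2, Matrix.det_one, one_pow, one_smul, one_smul] at h1
  rw [eval_eq_eval_spec ν pt v' g.1 (pt' := ptAct ν g pt) (fun _ => rfl), ← h1, ← eval_sumElim_eq]
  · congr 2
    funext c
    rcases c with c | c <;> rfl
  · intro i
    simp [ptAct]

theorem isWeightedHomogeneous_transvect {ι : Type} {ν : ι → ℕ} {U W : CoordRing ν} {u v r : ℕ}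
    (hU : U.IsWeightedHomogeneous (ordWt ν) (u + r : ℕ))
    (hW : W.IsWeightedHomogeneous (ordWt ν) (v + r : ℕ)) :
    (transvect ν (u + r) (v + r) r U W).IsWeightedHomogeneous (ordWt ν) (u + v : ℕ) := by
  refine isWeightedHomogeneous_of_eval_dil fun s pt => ?_
  set f := fun c => pt (Sum.inl c)
  have h0 : ∀ (Q : CoordRing ν) x, eval (dil (ordWt ν) s (Sum.elim f fun i => x (Sum.inr i))) Q
      = eval x (spec ν f ((s : ℂ) • 1) Q) := by
    intro Q x
    apply eval_eq_eval_spec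
    · intro c
      simp [dil, ordWt]
    · intro i
      fin_cases i <;> simp [dil, ordWt]
  have h1 : ∀ (Q : CoordRing ν) x, eval (Sum.elim f fun i => x (Sum.inr i)) Q
      = eval x (spec ν f 1 Q) :=
    fun Q x => eval_sumElim_eq ν x f Q
  have key : ∀ (Q : CoordRing ν) (l : ℕ), Q.IsWeightedHomogeneous (ordWt ν) l →
      spec ν f ((s : ℂ) • 1) Q = (s : ℂ) ^ l • spec ν f 1 Q := by
    intro Q l hQ
    refine MvPolynomial.funext fun x => ?_
    rw [← h0, eval_dil hQ, smul_eval, ← h1, zpow_natCast]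
  have h2 := transvect_spec ν f ((s : ℂ) • 1) (u + r) (v + r) r U W
  have hpt : pt = Sum.elim f fun i => pt (Sum.inr i) := by
    funext c; rcases c with c | c <;> rfl
  rw [key U _ hU, key W _ hW, ← transvectBilin_apply, map_smul, map_smul, LinearMap.smul_apply,
    transvectBilin_apply, transvect_spec, Matrix.det_one, one_pow, one_smul] at h2
  have h3 := congrArg (eval pt) h2
  simp only [smul_eval, Matrix.det_smul, Matrix.det_one, ← h0, ← h1, ← hpt, Fintype.card_fin,
    mul_one] at h3
  have hs := s.ne_zero
  have h4 : ((s : ℂ) ^ 2) ^ r ≠ 0 := pow_ne_zero _ (pow_ne_zero _ hs)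
  refine mul_left_cancel₀ h4 (h3.symm.trans ?_)
  rw [zpow_natCast]
  ring

end GordanCov

namespace GordanCov

open Filter Topology

/-- The covariant `P`, evaluated at the vector `e`. -/
def atVec {ι : Type} (ν : ι → ℕ) (e : Fin 2 → ℂ) :
    CoordRing ν →ₐ[ℂ] MvPolynomial (Σ i : ι, Fin (ν i + 1)) ℂ :=
  aeval (Sum.elim X fun i => C (e i))

theorem eval_atVec {ι : Type} (ν : ι → ℕ) (e : Fin 2 → ℂ) (v : (Σ i : ι, Fin (ν i + 1)) → ℂ)
    (P : CoordRing ν) : eval v (atVec ν e P) = eval (Sum.elim v e) P := by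
  induction P using MvPolynomial.induction_on with
  | C a => simp [atVec]
  | add p q hp hq => rw [map_add, map_add, map_add, hp, hq]
  | mul_X p c hp =>
    rw [map_mul, map_mul, map_mul, hp]
    rcases c with c | c <;> simp [atVec]

/-- The binary form obtained from `P` by specialising the coefficients. -/
def atForm {ι : Type} (ν : ι → ℕ) (v : (Σ i : ι, Fin (ν i + 1)) → ℂ) :
    CoordRing ν →ₐ[ℂ] MvPolynomial (Fin 2) ℂ :=
  aeval (Sum.elim (fun c => C (v c)) X)

theorem eval_atForm {ι : Type} (ν : ι → ℕ) (v : (Σ i : ι, Fin (ν i + 1)) → ℂ) (e : Fin 2 → ℂ)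
    (P : CoordRing ν) : eval e (atForm ν v P) = eval (Sum.elim v e) P := by
  induction P using MvPolynomial.induction_on with
  | C a => simp [atForm]
  | add p q hp hq => rw [map_add, map_add, map_add, hp, hq]
  | mul_X p c hp =>
    rw [map_mul, map_mul, map_mul, hp]
    rcases c with c | c <;> simp [atForm]

theorem eval_form (k : ℕ) (a : Fin (k + 1) → ℂ) (x : Fin 2 → ℂ) :
    eval x (form k a) = ∑ i, a i * x 0 ^ (k - (i : ℕ)) * x 1 ^ (i : ℕ) := by
  simp [form]

theorem atForm_eq_form {ι : Type} {ν : ι → ℕ} (v : (Σ i : ι, Fin (ν i + 1)) → ℂ) {P : CoordRing ν}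
    {k : ℕ} (hP : P.IsWeightedHomogeneous (ordWt ν) k) :
    atForm ν v P = form k (coeffOf k (atForm ν v P)) := by
  refine (form_coeffOf ?_).symm
  have h1 : (atForm ν v P).IsWeightedHomogeneous (fun _ => (1 : ℤ)) k := by
    refine isWeightedHomogeneous_of_eval_dil fun s x => ?_
    rw [eval_atForm, eval_atForm, ← eval_dil hP]
    congr 2
    funext c
    rcases c with c | c <;> simp [dil, ordWt]
  intro d hd
  have h2 := h1 hd
  simp only [Finsupp.weight_apply, Finsupp.sum, Pi.one_apply, smul_eq_mul, mul_one,
    nsmul_eq_mul] at h2 ⊢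
  exact_mod_cast h2

theorem eval_form_e1 (k : ℕ) (a : Fin (k + 1) → ℂ) : eval ![1, 0] (form k a) = a 0 := by
  rw [eval_form, Finset.sum_eq_single 0]
  · simp
  · intro i _ hi
    have : (i : ℕ) ≠ 0 := fun h => hi (Fin.ext h)
    simp [this]
  · simp

theorem eval_form_e2 (k : ℕ) (a : Fin (k + 1) → ℂ) : eval ![0, 1] (form k a) = a (Fin.last k) := by
  rw [eval_form, Finset.sum_eq_single (Fin.last k)]
  · simp
  · intro i _ hi
    have : (i : ℕ) < k := lt_of_le_of_ne (Nat.le_of_lt_succ i.2) fun h => hi (Fin.ext h)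
    simp [Nat.sub_ne_zero_of_lt this]
  · simp

section
variable {ι₁ ι₂ : Type} (n : ι₁ → ℕ) (m : ι₂ → ℕ)

/-- The point of `V₁ ⊕ ℂ²` under a point of `V₁ ⊕ V₂ ⊕ ℂ²`. -/
def ptL (pt : Var (Sum.elim n m) → ℂ) : Var n → ℂ :=
  Sum.elim (fun c => pt (Sum.inl ⟨Sum.inl c.1, c.2⟩)) fun i => pt (Sum.inr i)

/-- The point of `V₂ ⊕ ℂ²` under a point of `V₁ ⊕ V₂ ⊕ ℂ²`. -/
def ptR (pt : Var (Sum.elim n m) → ℂ) : Var m → ℂ :=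
  Sum.elim (fun c => pt (Sum.inl ⟨Sum.inr c.1, c.2⟩)) fun i => pt (Sum.inr i)

theorem eval_embL (pt : Var (Sum.elim n m) → ℂ) (U : CoordRing n) :
    eval pt (embL n m U) = eval (ptL n m pt) U := by
  rw [embL, eval_rename]
  congr 2
  funext c
  rcases c with c | c <;> rfl

theorem eval_embR (pt : Var (Sum.elim n m) → ℂ) (U : CoordRing m) :
    eval pt (embR n m U) = eval (ptR n m pt) U := by
  rw [embR, eval_rename]
  congr 2
  funext c
  rcases c with c | c <;> rfl

theorem embL_mem {U : CoordRing n} (hU : U ∈ Covariants n) :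
    embL n m U ∈ Covariants (Sum.elim n m) := by
  intro g pt
  rw [eval_embL, eval_embL, ← hU g (ptL n m pt)]
  congr 2

theorem embR_mem {U : CoordRing m} (hU : U ∈ Covariants m) :
    embR n m U ∈ Covariants (Sum.elim n m) := by
  intro g pt
  rw [eval_embR, eval_embR, ← hU g (ptR n m pt)]
  congr 2

theorem embL_isWeightedHomogeneous {U : CoordRing n} {k : ℤ}
    (hU : U.IsWeightedHomogeneous (ordWt n) k) :
    (embL n m U).IsWeightedHomogeneous (ordWt (Sum.elim n m)) k := by
  refine isWeightedHomogeneous_of_eval_dil fun s pt => ?_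
  rw [eval_embL, eval_embL, ← eval_dil hU]
  congr 2
  funext c
  rcases c with c | c <;> rfl

theorem embR_isWeightedHomogeneous {U : CoordRing m} {k : ℤ}
    (hU : U.IsWeightedHomogeneous (ordWt m) k) :
    (embR n m U).IsWeightedHomogeneous (ordWt (Sum.elim n m)) k := by
  refine isWeightedHomogeneous_of_eval_dil fun s pt => ?_
  rw [eval_embR, eval_embR, ← eval_dil hU]
  congr 2
  funext c
  rcases c with c | c <;> rfl

/-- The action of `SL(2,ℂ)³` on `V₁ ⊕ V₂ ⊕ ℂ²`. -/
def act3 (g₁ g₂ h : SL2) (pt : Var (Sum.elim n m) → ℂ) : Var (Sum.elim n m) → ℂ :=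
  actFam (Sum.elim n m) (Sum.elim (fun _ => g₁) fun _ => g₂) h pt

theorem act3_mul (g₁ g₂ h g₁' g₂' h' : SL2) (pt : Var (Sum.elim n m) → ℂ) :
    act3 n m g₁ g₂ h (act3 n m g₁' g₂' h' pt) = act3 n m (g₁ * g₁') (g₂ * g₂') (h * h') pt := by
  rw [act3, act3, actFam_mul, act3]
  congr 1
  funext i
  rcases i with i | i <;> rfl

theorem act3_one (pt : Var (Sum.elim n m) → ℂ) : act3 n m 1 1 1 pt = pt := by
  rw [act3]
  convert actFam_one _ pt using 2
  funext i
  rcases i with i | i <;> rfl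

theorem ptAct_eq_act3 (g : SL2) (pt : Var (Sum.elim n m) → ℂ) :
    ptAct (Sum.elim n m) g pt = act3 n m g g g pt := by
  rw [ptAct_eq_actFam, act3]
  congr 1
  funext i
  rcases i with i | i <;> rfl

/-- The weight for the torus acting by `τ` on `V₁`, by `τ⁻¹` on `V₂` and trivially on `ℂ²`. -/
def antiWt : Var (Sum.elim n m) → ℤ
  | Sum.inl ⟨Sum.inl i, j⟩ => 2 * (j : ℕ) - n i
  | Sum.inl ⟨Sum.inr i, j⟩ => -(2 * (j : ℕ) - m i)
  | Sum.inr _ => 0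

/-- The weight for the diagonal torus action. -/
def diagWt : Var (Sum.elim n m) → ℤ
  | Sum.inl c => 2 * (c.2 : ℕ) - (Sum.elim n m c.1 : ℕ)
  | Sum.inr i => 1 - 2 * (i : ℕ)

theorem dil_antiWt (s : ℂˣ) (pt : Var (Sum.elim n m) → ℂ) :
    dil (antiWt n m) s pt = act3 n m (tau s) (tau s⁻¹) 1 pt := by
  funext c
  rcases c with ⟨i | i, j⟩ | i
  · exact (coeffAct_tau s (n i) (fun k => pt (Sum.inl ⟨Sum.inl i, k⟩)) j).symm
  · refine Eq.trans ?_ (coeffAct_tau s⁻¹ (m i) (fun k => pt (Sum.inl ⟨Sum.inr i, k⟩)) j).symm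
    rw [Units.val_inv_eq_inv_val, inv_zpow, ← zpow_neg]
    rfl
  · fin_cases i <;> simp [dil, antiWt, act3, actFam]

theorem dil_diagWt (s : ℂˣ) (pt : Var (Sum.elim n m) → ℂ) :
    dil (diagWt n m) s pt = act3 n m (tau s) (tau s) (tau s) pt := by
  funext c
  rcases c with ⟨i | i, j⟩ | i
  · exact (coeffAct_tau s (n i) (fun k => pt (Sum.inl ⟨Sum.inl i, k⟩)) j).symm
  · exact (coeffAct_tau s (m i) (fun k => pt (Sum.inl ⟨Sum.inr i, k⟩)) j).symm
  · fin_cases i <;> simp [dil, diagWt, act3, actFam, tau]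

/-- The leading term, up to a scalar, of the transvectant `⟨U, W⟩_r` of order `u + v`. -/
def leadTerm (u v : ℕ) (U : CoordRing n) (W : CoordRing m) : CoordRing (Sum.elim n m) :=
  rename (fun c => Sum.inl ⟨Sum.inl c.1, c.2⟩) (atVec n ![0, 1] U)
    * rename (fun c => Sum.inl ⟨Sum.inr c.1, c.2⟩) (atVec m ![1, 0] W)
    * X (Sum.inr 1) ^ u * X (Sum.inr 0) ^ v

theorem leadTerm_mul (u v u' v' : ℕ) (U U' : CoordRing n) (W W' : CoordRing m) :
    leadTerm n m u v U W * leadTerm n m u' v' U' W' = leadTerm n m (u + u') (v + v') (U * U') (W * W') := by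
  simp only [leadTerm, map_mul, pow_add]
  ring

theorem eval_leadTerm (u v : ℕ) (U : CoordRing n) (W : CoordRing m) (pt : Var (Sum.elim n m) → ℂ) :
    eval pt (leadTerm n m u v U W) =
      eval (Sum.elim (fun c => pt (Sum.inl ⟨Sum.inl c.1, c.2⟩)) ![0, 1]) U
        * eval (Sum.elim (fun c => pt (Sum.inl ⟨Sum.inr c.1, c.2⟩)) ![1, 0]) W
        * pt (Sum.inr 1) ^ u * pt (Sum.inr 0) ^ v := by
  simp only [leadTerm, map_mul, map_pow, eval_X, eval_rename, eval_atVec]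
  rfl

end

end GordanCov

namespace GordanCov

open Filter Topology

theorem tendsto_torus_coeff (k b : ℕ) (hb : b ≤ k) :
    Tendsto (fun i => (seqUnit i : ℂ) ^ (-(k : ℤ)) * ((seqUnit i : ℂ)⁻¹ ^ (k - b) * (seqUnit i : ℂ) ^ b))
      atTop (𝓝 (if b = k then 1 else 0)) := by
  have h : ∀ i, (seqUnit i : ℂ) ^ (-(k : ℤ)) * ((seqUnit i : ℂ)⁻¹ ^ (k - b) * (seqUnit i : ℂ) ^ b)
      = (seqUnit i : ℂ) ^ (2 * (b : ℤ) - 2 * k) := by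
    intro i
    have hs := (seqUnit i).ne_zero
    rw [inv_pow, ← zpow_natCast, ← zpow_natCast, ← zpow_neg, ← zpow_add₀ hs, ← zpow_add₀ hs]
    congr 1
    push_cast [hb]
    ring
  simp only [h]
  split_ifs with hbk
  · simp [hbk]
  · exact tendsto_seqUnit_zpow (by omega)

section
variable {ι₁ ι₂ : Type} (n : ι₁ → ℕ) (m : ι₂ → ℕ)

theorem exists_hasTop_transvect (u v r : ℕ) : ∃ c : ℂ, c ≠ 0 ∧
    ∀ U ∈ Covariants n, ∀ W ∈ Covariants m,
      U.IsWeightedHomogeneous (ordWt n) (u + r : ℕ) → W.IsWeightedHomogeneous (ordWt m) (v + r : ℕ) →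
      HasTop (antiWt n m) ((u + r : ℕ) + (v + r : ℕ))
        (transvect (Sum.elim n m) (u + r) (v + r) r (embL n m U) (embR n m W))
        (c • leadTerm n m u v U W) := by
  obtain ⟨c, hc, hcr⟩ := exists_transvect_eq_smul (Sum.elim n m) u v r
  refine ⟨c, hc, fun U hU W hW hUo hWo pt => ?_⟩
  set k := u + r
  set l := v + r
  set fL : (Σ i : ι₁, Fin (n i + 1)) → ℂ := fun c => pt (Sum.inl ⟨Sum.inl c.1, c.2⟩)
  set fR : (Σ i : ι₂, Fin (m i + 1)) → ℂ := fun c => pt (Sum.inl ⟨Sum.inr c.1, c.2⟩)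
  set A := coeffOf k (atForm n fL U)
  set B := coeffOf l (atForm m fR W)
  let vs : ℕ → (Σ i : ι₁ ⊕ ι₂, Fin (Sum.elim n m i + 1)) → ℂ :=
    fun i c => dil (antiWt n m) (seqUnit i) pt (Sum.inl c)
  let mon : ℕ → ℕ → CoordRing (Sum.elim n m) := fun a b => X (Sum.inr 0) ^ a * X (Sum.inr 1) ^ b
  have hpts : ∀ i, dil (antiWt n m) (seqUnit i) pt = Sum.elim (vs i) fun j => pt (Sum.inr j) := by
    intro i
    funext c
    rcases c with c | c
    · rfl
    · simp [dil, antiWt]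
  have hspL : ∀ i, spec _ (vs i) 1 (embL n m U) = ∑ b : Fin (k + 1),
      (A b * ((seqUnit i : ℂ)⁻¹ ^ (k - (b : ℕ)) * (seqUnit i : ℂ) ^ (b : ℕ))) • mon (k - b) b := by
    intro i
    refine MvPolynomial.funext fun x => ?_
    rw [← eval_sumElim_eq, eval_embL, ← hU (tau (seqUnit i)⁻¹)]
    have h1 : ptAct n (tau (seqUnit i)⁻¹) (ptL n m (Sum.elim (vs i) fun j => x (Sum.inr j)))
        = Sum.elim fL ![(seqUnit i : ℂ)⁻¹ * x (Sum.inr 0), (seqUnit i : ℂ) * x (Sum.inr 1)] := by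
      have h2 : ptL n m (Sum.elim (vs i) fun j => x (Sum.inr j))
          = actFam n (fun _ => tau (seqUnit i)) 1 (Sum.elim fL fun j => x (Sum.inr j)) := by
        funext c
        rcases c with c | c
        · change dil (antiWt n m) (seqUnit i) pt _ = _
          rw [dil_antiWt]
          rfl
        · fin_cases c <;> simp [ptL, actFam]
      rw [h2, ptAct_eq_actFam, actFam_mul, mul_one]
      funext c
      rcases c with c | c
      · simp only [actFam, Sum.elim_inl, Pi.mul_apply, tau_inv_mul_tau, coeffAct_one]
      · fin_cases c <;> simp [actFam, tau]
    rw [h1, ← eval_atForm, atForm_eq_form fL hUo, eval_form, map_sum]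
    refine Finset.sum_congr rfl fun b _ => ?_
    simp only [mon, smul_eval, map_mul, map_pow, eval_X, Matrix.cons_val_zero, Matrix.cons_val_one,
      mul_pow]
    ring
  have hspR : ∀ i, spec _ (vs i) 1 (embR n m W) = ∑ b : Fin (l + 1),
      (B b * ((seqUnit i : ℂ) ^ (l - (b : ℕ)) * (seqUnit i : ℂ)⁻¹ ^ (b : ℕ))) • mon (l - b) b := by
    intro i
    refine MvPolynomial.funext fun x => ?_
    rw [← eval_sumElim_eq, eval_embR, ← hW (tau (seqUnit i))]
    have h1 : ptAct m (tau (seqUnit i)) (ptR n m (Sum.elim (vs i) fun j => x (Sum.inr j)))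
        = Sum.elim fR ![(seqUnit i : ℂ) * x (Sum.inr 0), (seqUnit i : ℂ)⁻¹ * x (Sum.inr 1)] := by
      have h2 : ptR n m (Sum.elim (vs i) fun j => x (Sum.inr j))
          = actFam m (fun _ => tau (seqUnit i)⁻¹) 1 (Sum.elim fR fun j => x (Sum.inr j)) := by
        funext c
        rcases c with c | c
        · change dil (antiWt n m) (seqUnit i) pt _ = _
          rw [dil_antiWt]
          rfl
        · fin_cases c <;> simp [ptR, actFam]
      rw [h2, ptAct_eq_actFam, actFam_mul, mul_one]
      funext c
      rcases c with c | c
      · simp only [actFam, Sum.elim_inl, Pi.mul_apply, tau_mul_tau_inv, coeffAct_one]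
      · fin_cases c <;> simp [actFam, tau]
    rw [h1, ← eval_atForm, atForm_eq_form fR hWo, eval_form, map_sum]
    refine Finset.sum_congr rfl fun b _ => ?_
    simp only [mon, smul_eval, map_mul, map_pow, eval_X, Matrix.cons_val_zero, Matrix.cons_val_one,
      mul_pow]
    ring
  have hev : ∀ i, eval (dil (antiWt n m) (seqUnit i) pt)
      (transvect (Sum.elim n m) k l r (embL n m U) (embR n m W))
      = ∑ b : Fin (k + 1), ∑ a : Fin (l + 1),
        (A b * ((seqUnit i : ℂ)⁻¹ ^ (k - (b : ℕ)) * (seqUnit i : ℂ) ^ (b : ℕ)))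
          * ((B a * ((seqUnit i : ℂ) ^ (l - (a : ℕ)) * (seqUnit i : ℂ)⁻¹ ^ (a : ℕ)))
          * eval pt (transvect (Sum.elim n m) k l r (mon (k - b) b) (mon (l - a) a))) := by
    intro i
    have h1 := transvect_spec (Sum.elim n m) (vs i) 1 k l r (embL n m U) (embR n m W)
    rw [Matrix.det_one, one_pow, one_smul] at h1
    rw [hpts, eval_sumElim_eq, ← h1, hspL, hspR, ← transvectBilin_apply, LinearMap.map_sum₂, map_sum]
    refine Finset.sum_congr rfl fun b _ => ?_
    rw [map_sum, map_sum]
    refine Finset.sum_congr rfl fun a _ => ?_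
    rw [map_smul, smul_eval, map_smul, LinearMap.smul_apply, smul_eval, transvectBilin_apply]
    ring
  have hlim : Tendsto (fun i => ∑ b : Fin (k + 1), ∑ a : Fin (l + 1),
      (A b * ((seqUnit i : ℂ) ^ (-(k : ℤ)) * ((seqUnit i : ℂ)⁻¹ ^ (k - (b : ℕ)) * (seqUnit i : ℂ) ^ (b : ℕ))))
      * ((B a * ((seqUnit i : ℂ) ^ (-(l : ℤ)) * ((seqUnit i : ℂ)⁻¹ ^ (l - (l - (a : ℕ)))
        * (seqUnit i : ℂ) ^ (l - (a : ℕ)))))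
      * eval pt (transvect (Sum.elim n m) k l r (mon (k - b) b) (mon (l - a) a)))) atTop
      (𝓝 (∑ b : Fin (k + 1), ∑ a : Fin (l + 1), (A b * if (b : ℕ) = k then 1 else 0) *
        ((B a * if l - (a : ℕ) = l then 1 else 0)
        * eval pt (transvect (Sum.elim n m) k l r (mon (k - b) b) (mon (l - a) a))))) := by
    refine tendsto_finsetSum _ fun b _ => tendsto_finsetSum _ fun a _ => ?_
    refine ((tendsto_torus_coeff k b (Nat.le_of_lt_succ b.2)).const_mul _).mul
      (((tendsto_torus_coeff l (l - a) (Nat.sub_le _ _)).const_mul _).mul_const _)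
  have hval : (∑ b : Fin (k + 1), ∑ a : Fin (l + 1), (A b * if (b : ℕ) = k then 1 else 0) *
        ((B a * if l - (a : ℕ) = l then 1 else 0)
        * eval pt (transvect (Sum.elim n m) k l r (mon (k - b) b) (mon (l - a) a))))
      = eval pt (c • leadTerm n m u v U W) := by
    rw [Finset.sum_eq_single (Fin.last k), Finset.sum_eq_single 0]
    · have h1 : A (Fin.last k) = eval (Sum.elim fL ![0, 1]) U := by
        rw [← eval_atForm, atForm_eq_form fL hUo, eval_form_e2]
      have h2 : B 0 = eval (Sum.elim fR ![1, 0]) W := by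
        rw [← eval_atForm, atForm_eq_form fR hWo, eval_form_e1]
      have h3 : transvect (Sum.elim n m) k l r (mon (k - (Fin.last k : ℕ)) (Fin.last k : ℕ))
          (mon (l - ((0 : Fin (l + 1)) : ℕ)) ((0 : Fin (l + 1)) : ℕ))
          = c • (X (Sum.inr 1) ^ u * X (Sum.inr 0) ^ v) := by
        simpa [mon] using hcr
      rw [h1, h2, h3, smul_eval, smul_eval, eval_leadTerm]
      simp [fL, fR]
      ring
    · intro a _ ha
      have : l - (a : ℕ) ≠ l := by
        have h1 : (a : ℕ) ≠ 0 := fun h => ha (Fin.ext h)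
        have := a.2
        omega
      simp [this]
    · simp
    · intro b _ hb
      have : (b : ℕ) ≠ k := fun h => hb (Fin.ext h)
      simp [this]
    · simp
  rw [← hval]
  refine hlim.congr fun i => ?_
  rw [hev, Finset.mul_sum]
  refine Finset.sum_congr rfl fun b _ => ?_
  rw [Finset.mul_sum]
  refine Finset.sum_congr rfl fun a _ => ?_
  rw [neg_add, zpow_add₀ (Units.ne_zero _), Nat.sub_sub_self (Nat.le_of_lt_succ a.2)]
  ring

end

end GordanCov

namespace GordanCov

/-- The polynomial functions. -/
def polyFun (σ : Type*) : Subalgebra ℂ ((σ → ℂ) → ℂ) where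
  carrier := {φ | ∃ P : MvPolynomial σ ℂ, ∀ pt, φ pt = eval pt P}
  mul_mem' := by
    rintro _ _ ⟨P, hP⟩ ⟨Q, hQ⟩
    exact ⟨P * Q, fun pt => by rw [Pi.mul_apply, hP, hQ, map_mul]⟩
  add_mem' := by
    rintro _ _ ⟨P, hP⟩ ⟨Q, hQ⟩
    exact ⟨P + Q, fun pt => by rw [Pi.add_apply, hP, hQ, map_add]⟩
  algebraMap_mem' c := ⟨C c, fun pt => by simp⟩

theorem coord_mem_polyFun {σ : Type*} (c : σ) : (fun pt : σ → ℂ => pt c) ∈ polyFun σ :=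
  ⟨X c, fun pt => by simp⟩

theorem const_mem_polyFun {σ : Type*} (a : ℂ) : (fun _ : σ → ℂ => a) ∈ polyFun σ :=
  ⟨C a, fun pt => by simp⟩

theorem eq_of_eq_off_zeros {σ : Type*} {P Q q : MvPolynomial σ ℂ} (hq : q ≠ 0)
    (h : ∀ pt, eval pt q ≠ 0 → eval pt P = eval pt Q) : P = Q := by
  have h1 : (P - Q) * q = 0 := by
    refine MvPolynomial.funext fun pt => ?_
    rw [map_mul, map_sub, map_zero]
    by_cases h0 : eval pt q = 0
    · rw [h0, mul_zero]
    · rw [h pt h0, sub_self, zero_mul]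
  exact sub_eq_zero.1 ((mul_eq_zero.1 h1).resolve_right hq)

/-- The regular functions on the open set where `q` does not vanish. -/
def locFun {σ : Type*} (q : MvPolynomial σ ℂ) :
    Subalgebra ℂ ({pt : σ → ℂ // eval pt q ≠ 0} → ℂ) where
  carrier := {φ | ∃ (M : ℕ) (A : MvPolynomial σ ℂ), ∀ pt, eval pt.1 q ^ M * φ pt = eval pt.1 A}
  mul_mem' := by
    rintro φ ψ ⟨M, P, hP⟩ ⟨L, Q, hQ⟩
    exact ⟨M + L, P * Q, fun pt => by rw [Pi.mul_apply, map_mul, ← hP, ← hQ]; ring⟩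
  add_mem' := by
    rintro φ ψ ⟨M, P, hP⟩ ⟨L, Q, hQ⟩
    exact ⟨M + L, q ^ L * P + q ^ M * Q, fun pt => by
      rw [Pi.add_apply, map_add, map_mul, map_mul, ← hP, ← hQ, map_pow, map_pow]; ring⟩
  algebraMap_mem' c := ⟨0, C c, fun pt => by simp⟩

theorem eval_mem_locFun {σ : Type*} (q P : MvPolynomial σ ℂ) :
    (fun pt : {pt : σ → ℂ // eval pt q ≠ 0} => eval pt.1 P) ∈ locFun q :=
  ⟨0, P, fun pt => by simp⟩

theorem inv_mem_locFun {σ : Type*} (q : MvPolynomial σ ℂ) :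
    (fun pt : {pt : σ → ℂ // eval pt q ≠ 0} => (eval pt.1 q)⁻¹) ∈ locFun q :=
  ⟨1, 1, fun pt => by rw [pow_one, mul_inv_cancel₀ pt.2, map_one]⟩

section
variable {ι : Type} (ν : ι → ℕ)

/-- The action of `SL(2,ℂ)` on `V`. -/
def vAct (g : SL2) (f : (Σ i : ι, Fin (ν i + 1)) → ℂ) : (Σ i : ι, Fin (ν i + 1)) → ℂ :=
  fun c => coeffAct g (ν c.1) (fun k => f ⟨c.1, k⟩) c.2

theorem vAct_mul (g h : SL2) (f : (Σ i : ι, Fin (ν i + 1)) → ℂ) :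
    vAct ν g (vAct ν h f) = vAct ν (g * h) f := by
  funext c
  simp only [vAct, coeffAct_mul]

theorem vAct_one (f : (Σ i : ι, Fin (ν i + 1)) → ℂ) : vAct ν 1 f = f := by
  funext c
  simp only [vAct, coeffAct_one]

theorem ptAct_sumElim (g : SL2) (f : (Σ i : ι, Fin (ν i + 1)) → ℂ) (x : Fin 2 → ℂ) :
    ptAct ν g (Sum.elim f x)
      = Sum.elim (vAct ν g f) fun i => g.1 i 0 * x 0 + g.1 i 1 * x 1 := by
  funext c
  rcases c with c | c
  · rfl
  · simp [ptAct]

theorem vAct_mem {T : Type*} (S : Subalgebra ℂ (T → ℂ)) {g : T → SL2}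
    {f : T → (Σ i : ι, Fin (ν i + 1)) → ℂ}
    (hg : ∀ i j, (fun t => (g t).1 i j) ∈ S) (hf : ∀ c, (fun t => f t c) ∈ S)
    (c : Σ i : ι, Fin (ν i + 1)) : (fun t => vAct ν (g t) (f t) c) ∈ S :=
  coeffAct_mem S hg (ν c.1) (fun _ => hf _) c.2

/-- A matrix in `SL(2,ℂ)` whose inverse sends `(x, y)` to `(0, 1)`, when `y ≠ 0`. -/
def moveInvY (x y : ℂ) (hy : y ≠ 0) : SL2 :=
  ⟨!![y, -x; 0, y⁻¹], by simp [Matrix.det_fin_two, hy]⟩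

/-- A matrix in `SL(2,ℂ)` sending `(x, y)` to `(0, 1)`, when `x ≠ 0`. -/
def moveInvX (x y : ℂ) (hx : x ≠ 0) : SL2 :=
  ⟨!![y, -x; x⁻¹, 0], by simp [Matrix.det_fin_two, hx]⟩

theorem eq_lower_mul {g h : SL2} {x y : ℂ}
    (hg0 : g.1 0 0 * x + g.1 0 1 * y = 0) (hg1 : g.1 1 0 * x + g.1 1 1 * y = 1)
    (hh0 : h.1 0 0 * x + h.1 0 1 * y = 0) (hh1 : h.1 1 0 * x + h.1 1 1 * y = 1) :
    ∃ t, g = lower t * h := by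
  have dg := g.2
  have dh := h.2
  rw [Matrix.det_fin_two] at dg dh
  have e1 : h.1 0 0 = y := by
    linear_combination (-h.1 0 0) * hh1 + h.1 1 0 * hh0 + y * dh
  have e2 : h.1 0 1 = -x := by
    linear_combination (-h.1 0 1) * hh1 + h.1 1 1 * hh0 - x * dh
  have e3 : g.1 0 0 = y := by
    linear_combination (-g.1 0 0) * hg1 + g.1 1 0 * hg0 + y * dg
  have e4 : g.1 0 1 = -x := by
    linear_combination (-g.1 0 1) * hg1 + g.1 1 1 * hg0 - x * dg
  rw [e1, e2] at dh
  rw [e3, e4] at dg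
  refine ⟨g.1 1 0 * h.1 1 1 - g.1 1 1 * h.1 1 0, ?_⟩
  apply sl2_ext <;> rw [mul_entry] <;> simp only [lower, Matrix.of_apply, Matrix.cons_val',
    Matrix.cons_val_zero, Matrix.cons_val_one, Matrix.cons_val_fin_one, e1, e2, e3, e4]
  · ring
  · ring
  · linear_combination (-g.1 1 0) * dh + h.1 1 0 * dg
  · linear_combination (-g.1 1 1) * dh + h.1 1 1 * dg

/-- A polynomial function on `V` invariant under the lower unipotent group is the coefficient of
a covariant. -/
theorem exists_covariant_of_lower {a : MvPolynomial (Σ i : ι, Fin (ν i + 1)) ℂ}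
    (ha : ∀ t f, eval (vAct ν (lower t) f) a = eval f a) :
    ∃ U ∈ Covariants ν, ∀ f, eval (Sum.elim f ![0, 1]) U = eval f a := by
  have hinv : ∀ (g h : SL2) (x y : ℂ) (f : (Σ i : ι, Fin (ν i + 1)) → ℂ),
      g.1 0 0 * x + g.1 0 1 * y = 0 → g.1 1 0 * x + g.1 1 1 * y = 1 →
      h.1 0 0 * x + h.1 0 1 * y = 0 → h.1 1 0 * x + h.1 1 1 * y = 1 →
      eval (vAct ν g f) a = eval (vAct ν h f) a := by
    intro g h x y f hg0 hg1 hh0 hh1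
    obtain ⟨t, rfl⟩ := eq_lower_mul hg0 hg1 hh0 hh1
    rw [← vAct_mul, ha]
  obtain ⟨M, A, hA⟩ : (fun pt : {pt : Var ν → ℂ // eval pt (X (Sum.inr 1)) ≠ 0} =>
      eval (vAct ν (moveInvY (pt.1 (Sum.inr 0)) (pt.1 (Sum.inr 1)) (by simpa using pt.2))
        fun c => pt.1 (Sum.inl c)) a) ∈ locFun (X (Sum.inr 1)) := by
    refine eval_mem_subalgebra _ (vAct_mem ν _ ?_ ?_) a
    · intro i j
      fin_cases i <;> fin_cases j <;> simp only [moveInvY, Fin.zero_eta, Fin.mk_one, Fin.isValue,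
        Matrix.of_apply, Matrix.cons_val', Matrix.cons_val_zero, Matrix.cons_val_one,
        Matrix.cons_val_fin_one]
      · simpa using eval_mem_locFun (X (Sum.inr 1) : CoordRing ν) (X (Sum.inr 1))
      · simpa using eval_mem_locFun (X (Sum.inr 1) : CoordRing ν) (-X (Sum.inr 0))
      · simpa using eval_mem_locFun (X (Sum.inr 1) : CoordRing ν) 0
      · simpa using inv_mem_locFun (X (Sum.inr 1) : CoordRing ν)
    · intro c
      simpa using eval_mem_locFun (X (Sum.inr 1) : CoordRing ν) (X (Sum.inl c))
  obtain ⟨L, B, hB⟩ : (fun pt : {pt : Var ν → ℂ // eval pt (X (Sum.inr 0)) ≠ 0} =>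
      eval (vAct ν (moveInvX (pt.1 (Sum.inr 0)) (pt.1 (Sum.inr 1)) (by simpa using pt.2))
        fun c => pt.1 (Sum.inl c)) a) ∈ locFun (X (Sum.inr 0)) := by
    refine eval_mem_subalgebra _ (vAct_mem ν _ ?_ ?_) a
    · intro i j
      fin_cases i <;> fin_cases j <;> simp only [moveInvX, Fin.zero_eta, Fin.mk_one, Fin.isValue,
        Matrix.of_apply, Matrix.cons_val', Matrix.cons_val_zero, Matrix.cons_val_one,
        Matrix.cons_val_fin_one]
      · simpa using eval_mem_locFun (X (Sum.inr 0) : CoordRing ν) (X (Sum.inr 1))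
      · simpa using eval_mem_locFun (X (Sum.inr 0) : CoordRing ν) (-X (Sum.inr 0))
      · simpa using inv_mem_locFun (X (Sum.inr 0) : CoordRing ν)
      · simpa using eval_mem_locFun (X (Sum.inr 0) : CoordRing ν) 0
    · intro c
      simpa using eval_mem_locFun (X (Sum.inr 0) : CoordRing ν) (X (Sum.inl c))
  have hYfix : ∀ (x y : ℂ) (hy : y ≠ 0), (moveInvY x y hy).1 0 0 * x + (moveInvY x y hy).1 0 1 * y = 0
      ∧ (moveInvY x y hy).1 1 0 * x + (moveInvY x y hy).1 1 1 * y = 1 := by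
    intro x y hy
    constructor <;> simp [moveInvY, hy]
    ring
  have hXfix : ∀ (x y : ℂ) (hx : x ≠ 0), (moveInvX x y hx).1 0 0 * x + (moveInvX x y hx).1 0 1 * y = 0
      ∧ (moveInvX x y hx).1 1 0 * x + (moveInvX x y hx).1 1 1 * y = 1 := by
    intro x y hx
    constructor <;> simp [moveInvX, hx]
    ring
  have hAB : (X (Sum.inr 0) : CoordRing ν) ^ L * A = X (Sum.inr 1) ^ M * B := by
    refine eq_of_eq_off_zeros (mul_ne_zero (X_ne_zero (Sum.inr 0)) (X_ne_zero (Sum.inr 1)))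
      fun pt hpt => ?_
    rw [map_mul] at hpt
    have h0 := left_ne_zero_of_mul hpt
    have h1 := right_ne_zero_of_mul hpt
    have e1 := hA ⟨pt, h1⟩
    have e2 := hB ⟨pt, h0⟩
    rw [eval_X] at h0 h1
    have e3 := hinv _ _ _ _ (fun c => pt (Sum.inl c)) (hYfix (pt (Sum.inr 0)) (pt (Sum.inr 1)) h1).1
      (hYfix (pt (Sum.inr 0)) (pt (Sum.inr 1)) h1).2 (hXfix (pt (Sum.inr 0)) (pt (Sum.inr 1)) h0).1
      (hXfix (pt (Sum.inr 0)) (pt (Sum.inr 1)) h0).2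
    dsimp only at e1 e2
    rw [map_mul, map_mul, ← e1, ← e2, e3, map_pow, map_pow]
    ring
  obtain ⟨U, rfl⟩ : X (Sum.inr 1) ^ M ∣ A := by
    refine X_prime.pow_dvd_of_dvd_mul_left M ?_ ⟨B, hAB⟩
    intro h
    have := X_prime.dvd_of_dvd_pow h
    rw [X_dvd_X] at this
    simp at this
  have hU : ∀ (pt : Var ν → ℂ) (k : SL2), pt (Sum.inr 1) ≠ 0 →
      k.1 0 0 * pt (Sum.inr 0) + k.1 0 1 * pt (Sum.inr 1) = 0 →
      k.1 1 0 * pt (Sum.inr 0) + k.1 1 1 * pt (Sum.inr 1) = 1 →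
      eval pt U = eval (vAct ν k fun c => pt (Sum.inl c)) a := by
    intro pt k hy h0 h1
    have e1 := hA ⟨pt, by simpa using hy⟩
    dsimp only at e1
    rw [map_mul, map_pow] at e1
    have hy' : eval pt (X (Sum.inr 1) : CoordRing ν) ≠ 0 := by simpa using hy
    rw [← mul_left_cancel₀ (pow_ne_zero _ hy') e1]
    exact hinv _ _ _ _ _ (hYfix _ _ hy).1 (hYfix _ _ hy).2 h0 h1
  refine ⟨U, ?_, ?_⟩
  · intro g pt
    obtain ⟨P, hP⟩ : (fun pt => eval (ptAct ν g pt) U) ∈ polyFun (Var ν) := by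
      refine eval_mem_subalgebra _ (fun c => ?_) U
      simp only [ptAct_eq_actFam]
      exact actFam_mem _ ν (fun _ _ _ => const_mem_polyFun _) (fun _ _ => const_mem_polyFun _)
        coord_mem_polyFun c
    replace hP : ∀ pt, eval (ptAct ν g pt) U = eval pt P := hP
    have hPU : P = U := by
      have hq : (C (g.1 1 0) * X (Sum.inr 0) + C (g.1 1 1) * X (Sum.inr 1) : CoordRing ν) ≠ 0 := by
        intro h
        have h0 := congrArg (eval (Sum.elim 0 ![1, 0])) h
        have h1 := congrArg (eval (Sum.elim 0 ![0, 1])) h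
        have := g.2
        simp at h0 h1
        rw [Matrix.det_fin_two, h0, h1] at this
        simp at this
      refine eq_of_eq_off_zeros (mul_ne_zero hq (X_ne_zero (Sum.inr 1))) fun pt hpt => ?_
      rw [map_mul] at hpt
      have h0 := left_ne_zero_of_mul hpt
      have h1 := right_ne_zero_of_mul hpt
      rw [eval_X] at h1
      simp only [map_add, map_mul, eval_C, eval_X] at h0
      have hk := hYfix (pt (Sum.inr 0)) (pt (Sum.inr 1)) h1
      set k := moveInvY (pt (Sum.inr 0)) (pt (Sum.inr 1)) h1
      rw [← hP, hU pt k h1 hk.1 hk.2]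
      have hd := g.2
      rw [Matrix.det_fin_two] at hd
      have hx : ∀ i, ptAct ν g pt (Sum.inr i) = g.1 i 0 * pt (Sum.inr 0) + g.1 i 1 * pt (Sum.inr 1) := by
        intro i
        simp [ptAct]
      have hi := inv_entries g
      have hkg : ∀ i, (k * g⁻¹).1 i 0 * ptAct ν g pt (Sum.inr 0) + (k * g⁻¹).1 i 1 * ptAct ν g pt (Sum.inr 1)
          = k.1 i 0 * pt (Sum.inr 0) + k.1 i 1 * pt (Sum.inr 1) := by
        intro i
        rw [hx, hx, mul_entry, mul_entry, hi]
        simp only [Matrix.of_apply, Matrix.cons_val', Matrix.cons_val_zero, Matrix.cons_val_one,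
          Matrix.cons_val_fin_one]
        linear_combination (k.1 i 0 * pt (Sum.inr 0) + k.1 i 1 * pt (Sum.inr 1)) * hd
      rw [hU (ptAct ν g pt) (k * g⁻¹) (by rw [hx]; exact h0) (by rw [hkg]; exact hk.1)
        (by rw [hkg]; exact hk.2)]
      have hv : (fun c => ptAct ν g pt (Sum.inl c)) = vAct ν g fun c => pt (Sum.inl c) := rfl
      rw [hv, vAct_mul, inv_mul_cancel_right]
    rw [hP, hPU]
  · intro f
    rw [hU _ 1 (by simp) (by simp) (by simp), vAct_one]
    rfl

theorem exists_covariant_of_upper {b : MvPolynomial (Σ i : ι, Fin (ν i + 1)) ℂ}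
    (hb : ∀ t f, eval (vAct ν (upper t) f) b = eval f b) :
    ∃ U ∈ Covariants ν, ∀ f, eval (Sum.elim f ![1, 0]) U = eval f b := by
  let w : SL2 := ⟨!![0, 1; -1, 0], by simp [Matrix.det_fin_two]⟩
  obtain ⟨a, ha⟩ : (fun f => eval (vAct ν w f) b) ∈ polyFun (Σ i : ι, Fin (ν i + 1)) :=
    eval_mem_subalgebra _ (vAct_mem ν _ (fun _ _ => const_mem_polyFun _) coord_mem_polyFun) b
  replace ha : ∀ f, eval (vAct ν w f) b = eval f a := ha
  obtain ⟨U, hU, hUa⟩ := exists_covariant_of_lower ν (a := a) fun t f => by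
    have : w * lower t = upper (-t) * w := by
      apply sl2_ext <;> simp only [mul_entry] <;> simp [w, lower, upper]
    rw [← ha, ← ha]
    rw [vAct_mul, this, ← vAct_mul, hb]
  refine ⟨U, hU, fun f => ?_⟩
  have h1 := hU w (Sum.elim (vAct ν w⁻¹ f) ![0, 1])
  rw [ptAct_sumElim, hUa, ← ha, vAct_mul, mul_inv_cancel, vAct_one] at h1
  rw [← h1]
  congr 2
  funext c
  rcases c with c | c
  · rfl
  · fin_cases c <;> simp [w]

theorem eq_zero_of_eval_e2 {P : CoordRing ν} (hP : P ∈ Covariants ν)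
    (h : ∀ f, eval (Sum.elim f ![0, 1]) P = 0) : P = 0 := by
  refine eq_of_eq_off_zeros (X_ne_zero (Sum.inr 1)) fun pt hpt => ?_
  rw [eval_X] at hpt
  have hk : ptAct ν (moveInvY (pt (Sum.inr 0)) (pt (Sum.inr 1)) hpt) pt
      = Sum.elim (vAct ν (moveInvY (pt (Sum.inr 0)) (pt (Sum.inr 1)) hpt)
        fun c => pt (Sum.inl c)) ![0, 1] := by
    funext c
    rcases c with c | c
    · rfl
    · fin_cases c <;> simp [ptAct, moveInvY, hpt]
      ring
  rw [← hP (moveInvY (pt (Sum.inr 0)) (pt (Sum.inr 1)) hpt), hk, h, map_zero]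

theorem component_mem_covariants {P : CoordRing ν} (hP : P ∈ Covariants ν) (l : ℤ) :
    weightedHomogeneousComponent (ordWt ν) l P ∈ Covariants ν := by
  classical
  intro g pt
  have hc : ∀ c, ∃ R : CoordRing ν, ∀ pt, ptAct ν g pt c = eval pt R := fun c => by
    simp only [ptAct_eq_actFam]
    exact actFam_mem (polyFun (Var ν)) ν (fun _ _ _ => const_mem_polyFun _)
      (fun _ _ => const_mem_polyFun _) coord_mem_polyFun c
  choose R hR using hc
  have hρ : ∀ (Q : CoordRing ν) pt, eval pt (bind₁ R Q) = eval (ptAct ν g pt) Q := by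
    intro Q pt
    induction Q using MvPolynomial.induction_on with
    | C a => simp
    | add p q hp hq => rw [map_add, map_add, map_add, hp, hq]
    | mul_X p c hp => rw [map_mul, map_mul, map_mul, hp, bind₁_X_right, eval_X, hR]
  have hhom : ∀ (Q : CoordRing ν) (k : ℤ), Q.IsWeightedHomogeneous (ordWt ν) k →
      (bind₁ R Q).IsWeightedHomogeneous (ordWt ν) k := by
    intro Q k hQ
    refine isWeightedHomogeneous_of_eval_dil fun s pt => ?_
    rw [hρ, hρ, ← eval_dil hQ]
    congr 2
    funext c
    rcases c with c | c
    · simp [ptAct, dil, ordWt]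
    · simp [ptAct, dil, ordWt]
      ring
  obtain ⟨S, hS⟩ := exists_finset_sum_component (ordWt ν) P
  have h1 : bind₁ R P = P := MvPolynomial.funext fun pt => by rw [hρ, hP]
  have h2 := congrArg (weightedHomogeneousComponent (ordWt ν) l) h1
  have h3 : weightedHomogeneousComponent (ordWt ν) l (bind₁ R P)
      = bind₁ R (weightedHomogeneousComponent (ordWt ν) l P) := by
    conv_lhs => rw [hS]
    conv_rhs => rw [hS]
    simp only [map_sum]
    refine Finset.sum_congr rfl fun k _ => ?_
    have hk := weightedHomogeneousComponent_isWeightedHomogeneous (w := ordWt ν) k P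
    rw [weightedHomogeneousComponent_of_mem (hhom _ k hk), weightedHomogeneousComponent_of_mem hk]
    split_ifs
    · rfl
    · rw [map_zero]
  rw [← hρ, ← h3, h2]

end

end GordanCov

namespace GordanCov

open Filter Topology

/-- The continuous functions on `ℂ`. -/
def contFun : Subalgebra ℂ (ℂ → ℂ) where
  carrier := {φ | Continuous φ}
  mul_mem' ha hb := Continuous.mul ha hb
  add_mem' ha hb := Continuous.add ha hb
  algebraMap_mem' _ := continuous_const

/-- The polynomial functions on `ℂ`. -/
def polyFunC : Subalgebra ℂ (ℂ → ℂ) where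
  carrier := {φ | ∃ H : Polynomial ℂ, ∀ c, φ c = H.eval c}
  mul_mem' := by
    rintro _ _ ⟨P, hP⟩ ⟨Q, hQ⟩
    exact ⟨P * Q, fun c => by rw [Pi.mul_apply, hP, hQ, Polynomial.eval_mul]⟩
  add_mem' := by
    rintro _ _ ⟨P, hP⟩ ⟨Q, hQ⟩
    exact ⟨P + Q, fun c => by rw [Pi.add_apply, hP, hQ, Polynomial.eval_add]⟩
  algebraMap_mem' c := ⟨Polynomial.C c, fun x => by simp⟩

theorem polynomial_eval_eq_zero {H : Polynomial ℂ} {z : ℕ → ℂ}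
    (hz : Tendsto (fun i => ‖z i‖) atTop atTop)
    (hH : Tendsto (fun i => H.eval (z i)) atTop (𝓝 0)) (c : ℂ) : H.eval c = 0 := by
  by_cases hd : 0 < H.degree
  · have h1 := H.tendsto_norm_atTop hd hz
    have h2 := hH.norm
    exact absurd h2 (not_tendsto_nhds_of_tendsto_atTop h1 _)
  · rw [Polynomial.eq_C_of_degree_le_zero (not_lt.1 hd)] at hH ⊢
    simp only [Polynomial.eval_C] at hH ⊢
    exact tendsto_nhds_unique tendsto_const_nhds hH

/-- The sequence `s⁻²` for `s` in the sequence `seqUnit`. -/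
def seqEps (i : ℕ) : ℂ := (seqUnit i : ℂ)⁻¹ * (seqUnit i : ℂ)⁻¹

theorem tendsto_seqEps : Tendsto seqEps atTop (𝓝 0) := by
  have h := tendsto_seqUnit_inv.mul tendsto_seqUnit_inv
  rwa [mul_zero] at h

section
variable {ι₁ ι₂ : Type} (n : ι₁ → ℕ) (m : ι₂ → ℕ)

theorem act3_mem {T : Type*} (S : Subalgebra ℂ (T → ℂ)) {g₁ g₂ h : T → SL2}
    (hg₁ : ∀ i j, (fun t => (g₁ t).1 i j) ∈ S) (hg₂ : ∀ i j, (fun t => (g₂ t).1 i j) ∈ S)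
    (hh : ∀ i j, (fun t => (h t).1 i j) ∈ S) (pt : Var (Sum.elim n m) → ℂ)
    (c : Var (Sum.elim n m)) : (fun t => act3 n m (g₁ t) (g₂ t) (h t) pt c) ∈ S := by
  refine actFam_mem S (Sum.elim n m) ?_ hh (fun c => S.algebraMap_mem (pt c)) c
  rintro (k | k) i j
  · exact hg₁ i j
  · exact hg₂ i j

theorem lower_mem {T : Type*} (S : Subalgebra ℂ (T → ℂ)) {φ : T → ℂ} (hφ : φ ∈ S) (i j : Fin 2) :
    (fun t => (lower (φ t)).1 i j) ∈ S := by
  fin_cases i <;> fin_cases j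
  · exact S.one_mem
  · exact S.zero_mem
  · exact hφ
  · exact S.one_mem

theorem upper_mem {T : Type*} (S : Subalgebra ℂ (T → ℂ)) {φ : T → ℂ} (hφ : φ ∈ S) (i j : Fin 2) :
    (fun t => (upper (φ t)).1 i j) ∈ S := by
  fin_cases i <;> fin_cases j
  · exact S.one_mem
  · exact hφ
  · exact S.zero_mem
  · exact S.one_mem

theorem const_entry_mem {T : Type*} (S : Subalgebra ℂ (T → ℂ)) (g : SL2) (i j : Fin 2) :
    (fun _ : T => g.1 i j) ∈ S :=
  S.algebraMap_mem (g.1 i j)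

theorem mul_entry_mem {T : Type*} (S : Subalgebra ℂ (T → ℂ)) {g h : T → SL2}
    (hg : ∀ i j, (fun t => (g t).1 i j) ∈ S) (hh : ∀ i j, (fun t => (h t).1 i j) ∈ S)
    (i j : Fin 2) : (fun t => (g t * h t).1 i j) ∈ S := by
  simp only [mul_entry]
  exact S.add_mem (S.mul_mem (hg i 0) (hh 0 j)) (S.mul_mem (hg i 1) (hh 1 j))

theorem lower_tau_inv (s : ℂˣ) (t : ℂ) :
    lower t * tau s⁻¹ = tau s⁻¹ * lower ((s : ℂ)⁻¹ * (s : ℂ)⁻¹ * t) := by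
  have := s.ne_zero
  apply sl2_ext <;> simp only [mul_entry] <;> simp [tau, lower]
  field_simp

theorem upper_tau (s : ℂˣ) (t : ℂ) :
    upper t * tau s = tau s * upper ((s : ℂ)⁻¹ * (s : ℂ)⁻¹ * t) := by
  have := s.ne_zero
  apply sl2_ext <;> simp only [mul_entry] <;> simp [tau, upper]
  field_simp

variable {n m}

theorem component_lower_invariant {P : CoordRing (Sum.elim n m)}
    (hP : P ∈ Covariants (Sum.elim n m)) {N : ℤ} (hN : WeightLE (antiWt n m) N P) (t : ℂ)
    (pt : Var (Sum.elim n m) → ℂ) :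
    eval (act3 n m (lower t) 1 1 pt) (weightedHomogeneousComponent (antiWt n m) N P)
      = eval pt (weightedHomogeneousComponent (antiWt n m) N P) := by
  have key : ∀ s : ℂˣ, eval (dil (antiWt n m) s (act3 n m (lower t) 1 1 pt)) P
      = eval (dil (antiWt n m) s (act3 n m 1
          (lower ((s : ℂ)⁻¹ * (s : ℂ)⁻¹ * (-((s : ℂ)⁻¹ * (s : ℂ)⁻¹ * t))))
          (lower (-((s : ℂ)⁻¹ * (s : ℂ)⁻¹ * t))) pt)) P := by
    intro s
    have h1 : lower (-((s : ℂ)⁻¹ * (s : ℂ)⁻¹ * t)) * (tau s * lower t) = tau s := by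
      rw [tau_mul_lower, ← mul_assoc, lower_mul_lower, neg_add_cancel, lower_zero, one_mul]
    rw [← hP (lower (-((s : ℂ)⁻¹ * (s : ℂ)⁻¹ * t))), ptAct_eq_act3, dil_antiWt, dil_antiWt]
    simp only [act3_mul, one_mul, mul_one, h1, lower_tau_inv]
  have h1 := hN.tendsto (pts := fun _ => act3 n m (lower t) 1 1 pt) fun c => tendsto_const_nhds
  have h2 := hN.tendsto (pts := fun i => act3 n m 1 (lower (seqEps i * (-(seqEps i * t))))
    (lower (-(seqEps i * t))) pt) (pt := pt) fun c => by
      have hc : Continuous fun x : ℂ => act3 n m 1 (lower (x * (-(x * t))))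
          (lower (-(x * t))) pt c :=
        act3_mem n m contFun (const_entry_mem _ 1)
          (lower_mem contFun (φ := fun x => x * (-(x * t)))
            (show Continuous fun x : ℂ => x * (-(x * t)) by fun_prop))
          (lower_mem contFun (φ := fun x => -(x * t))
            (show Continuous fun x : ℂ => -(x * t) by fun_prop)) pt c
      have h3 := (hc.tendsto 0).comp tendsto_seqEps
      simpa [lower_zero, act3_one, Function.comp_def] using h3
  refine tendsto_nhds_unique h1 (h2.congr fun i => ?_)
  rw [key]
  rfl

theorem component_upper_invariant {P : CoordRing (Sum.elim n m)}
    (hP : P ∈ Covariants (Sum.elim n m)) {N : ℤ} (hN : WeightLE (antiWt n m) N P) (t : ℂ)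
    (pt : Var (Sum.elim n m) → ℂ) :
    eval (act3 n m 1 (upper t) 1 pt) (weightedHomogeneousComponent (antiWt n m) N P)
      = eval pt (weightedHomogeneousComponent (antiWt n m) N P) := by
  have key : ∀ s : ℂˣ, eval (dil (antiWt n m) s (act3 n m 1 (upper t) 1 pt)) P
      = eval (dil (antiWt n m) s (act3 n m
          (upper ((s : ℂ)⁻¹ * (s : ℂ)⁻¹ * (-((s : ℂ)⁻¹ * (s : ℂ)⁻¹ * t)))) 1
          (upper (-((s : ℂ)⁻¹ * (s : ℂ)⁻¹ * t))) pt)) P := by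
    intro s
    have h := tau_mul_upper s⁻¹ t
    rw [Units.val_inv_eq_inv_val] at h
    have h1 : upper (-((s : ℂ)⁻¹ * (s : ℂ)⁻¹ * t)) * (tau s⁻¹ * upper t) = tau s⁻¹ := by
      rw [h, ← mul_assoc, upper_mul_upper, neg_add_cancel, upper_zero, one_mul]
    rw [← hP (upper (-((s : ℂ)⁻¹ * (s : ℂ)⁻¹ * t))), ptAct_eq_act3, dil_antiWt, dil_antiWt]
    simp only [act3_mul, one_mul, mul_one, h1, upper_tau]
  have h1 := hN.tendsto (pts := fun _ => act3 n m 1 (upper t) 1 pt) fun c => tendsto_const_nhds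
  have h2 := hN.tendsto (pts := fun i => act3 n m (upper (seqEps i * (-(seqEps i * t)))) 1
    (upper (-(seqEps i * t))) pt) (pt := pt) fun c => by
      have hc : Continuous fun x : ℂ => act3 n m (upper (x * (-(x * t)))) 1
          (upper (-(x * t))) pt c :=
        act3_mem n m contFun (upper_mem contFun (φ := fun x => x * (-(x * t)))
            (show Continuous fun x : ℂ => x * (-(x * t)) by fun_prop))
          (const_entry_mem _ 1)
          (upper_mem contFun (φ := fun x => -(x * t))
            (show Continuous fun x : ℂ => -(x * t) by fun_prop)) pt c
      have h3 := (hc.tendsto 0).comp tendsto_seqEps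
      simpa [upper_zero, act3_one, Function.comp_def] using h3
  refine tendsto_nhds_unique h1 (h2.congr fun i => ?_)
  rw [key]
  rfl

/-- A joint covariant of order `k` has leading weight at least `k`. -/
theorem eq_zero_of_weightLE {P : CoordRing (Sum.elim n m)}
    (hP : P ∈ Covariants (Sum.elim n m)) {k N : ℤ}
    (hk : P.IsWeightedHomogeneous (ordWt (Sum.elim n m)) k)
    (hN : WeightLE (antiWt n m) N P) (hkN : N < k) : P = 0 := by
  refine eq_zero_of_eval_e2 _ hP fun f => ?_
  set pt : Var (Sum.elim n m) → ℂ := Sum.elim f ![0, 1] with hpt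
  let w : SL2 := ⟨!![0, -1; 1, 0], by simp [Matrix.det_fin_two]⟩
  have key : ∀ s : ℂˣ, eval (act3 n m 1 (lower ((s : ℂ) * s)) 1 pt) P
      = (s : ℂ) ^ (N - k) * ((s : ℂ) ^ (-N) * eval (dil (antiWt n m) s (act3 n m
        (upper ((s : ℂ)⁻¹ * (s : ℂ)⁻¹ * (-1))) (w * upper ((s : ℂ)⁻¹ * (s : ℂ)⁻¹ * 1))
        (upper (-1)) pt)) P) := by
    intro s
    have hs := s.ne_zero
    have e1 : eval (act3 n m 1 (lower ((s : ℂ) * s)) 1 pt) P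
        = (s : ℂ) ^ (-k) * eval (act3 n m (tau s) (lower 1 * tau s) 1 pt) P := by
      have h1 : act3 n m (tau s) (lower 1 * tau s) (tau s) pt
          = dil (ordWt (Sum.elim n m)) s⁻¹ (act3 n m (tau s) (lower 1 * tau s) 1 pt) := by
        funext c
        rcases c with c | c
        · simp [act3, actFam, dil, ordWt]
        · fin_cases c <;> simp [act3, actFam, dil, ordWt, tau, hpt]
      rw [← hP (tau s), ptAct_eq_act3, act3_mul, tau_mul_lower, mul_one,
        show (s : ℂ)⁻¹ * (s : ℂ)⁻¹ * ((s : ℂ) * s) = 1 by field_simp, h1, eval_dil hk,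
        Units.val_inv_eq_inv_val, inv_zpow, zpow_neg]
    have e2 : eval (act3 n m (tau s) (lower 1 * tau s) 1 pt) P
        = eval (dil (antiWt n m) s (act3 n m
        (upper ((s : ℂ)⁻¹ * (s : ℂ)⁻¹ * (-1))) (w * upper ((s : ℂ)⁻¹ * (s : ℂ)⁻¹ * 1))
        (upper (-1)) pt)) P := by
      have h2 : upper (-1) * (lower 1 * tau s) = tau s⁻¹ * (w * upper ((s : ℂ)⁻¹ * (s : ℂ)⁻¹ * 1)) := by
        apply sl2_ext <;> simp only [mul_entry] <;> simp [tau, upper, lower, w]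
      rw [← hP (upper (-1)), ptAct_eq_act3, dil_antiWt, act3_mul, act3_mul, h2, upper_tau,
        mul_one (upper (-1)), one_mul]
    rw [e1, e2, ← mul_assoc, ← zpow_add₀ hs]
    congr 2
    ring
  obtain ⟨H, hH⟩ : (fun c : ℂ => eval (act3 n m 1 (lower c) 1 pt) P) ∈ polyFunC :=
    eval_mem_subalgebra _ (act3_mem n m polyFunC (const_entry_mem _ 1)
      (lower_mem polyFunC (φ := fun c => c) ⟨Polynomial.X, fun c => by simp⟩)
      (const_entry_mem _ 1) pt) P
  replace hH : ∀ c, eval (act3 n m 1 (lower c) 1 pt) P = H.eval c := hH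
  have h0 := hH 0
  rw [lower_zero, act3_one] at h0
  rw [h0]
  have h2 := hN.tendsto (pts := fun i => act3 n m (upper (seqEps i * (-1)))
    (w * upper (seqEps i * 1)) (upper (-1)) pt) (pt := act3 n m (upper (0 * (-1)))
    (w * upper (0 * 1)) (upper (-1)) pt) fun c => by
      have hc : Continuous fun x : ℂ => act3 n m (upper (x * (-1)))
          (w * upper (x * 1)) (upper (-1)) pt c :=
        act3_mem n m contFun (upper_mem contFun (φ := fun x => x * (-1))
            (show Continuous fun x : ℂ => x * (-1) by fun_prop))
          (mul_entry_mem _ (const_entry_mem _ w) (upper_mem contFun (φ := fun x => x * 1)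
            (show Continuous fun x : ℂ => x * 1 by fun_prop)))
          (const_entry_mem _ _) pt c
      exact (hc.tendsto 0).comp tendsto_seqEps
  have h3 := (tendsto_seqUnit_zpow (k := N - k) (by omega)).mul h2
  rw [zero_mul] at h3
  refine polynomial_eval_eq_zero (z := fun i => (seqUnit i : ℂ) * seqUnit i) ?_
    (h3.congr fun i => ?_) 0
  · have h4 : Tendsto (fun i : ℕ => (i : ℝ) + 1) atTop atTop :=
      tendsto_atTop_add_const_right _ _ tendsto_natCast_atTop_atTop
    refine (h4.atTop_mul_atTop₀ h4).congr fun i => ?_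
    have : ‖((i : ℂ) + 1)‖ = (i : ℝ) + 1 := by
      have := Complex.norm_natCast (i + 1)
      push_cast at this
      exact this
    simp [seqUnit, this]
  · rw [← hH, key]
    rfl

end

end GordanCov

namespace GordanCov

section
variable {ι₁ ι₂ : Type} (n : ι₁ → ℕ) (m : ι₂ → ℕ)

/-- Separation of the variables of `V₁`, `V₂` and `ℂ²`. -/
def splitVar : Var (Sum.elim n m) →
    (Σ i : ι₁, Fin (n i + 1)) ⊕ ((Σ i : ι₂, Fin (m i + 1)) ⊕ Fin 2)
  | Sum.inl ⟨Sum.inl i, j⟩ => Sum.inl ⟨i, j⟩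
  | Sum.inl ⟨Sum.inr i, j⟩ => Sum.inr (Sum.inl ⟨i, j⟩)
  | Sum.inr i => Sum.inr (Sum.inr i)

/-- The inverse of `splitVar`. -/
def joinVar : (Σ i : ι₁, Fin (n i + 1)) ⊕ ((Σ i : ι₂, Fin (m i + 1)) ⊕ Fin 2) →
    Var (Sum.elim n m)
  | Sum.inl c => Sum.inl ⟨Sum.inl c.1, c.2⟩
  | Sum.inr (Sum.inl c) => Sum.inl ⟨Sum.inr c.1, c.2⟩
  | Sum.inr (Sum.inr i) => Sum.inr i

theorem joinVar_splitVar (c : Var (Sum.elim n m)) : joinVar n m (splitVar n m c) = c := by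
  rcases c with ⟨i | i, j⟩ | i <;> rfl

/-- The span of the products `U(f, e₂) W(g, e₁) x₂ⁱ x₁ʲ`. -/
def leadSpan : Submodule ℂ (CoordRing (Sum.elim n m)) :=
  Submodule.span ℂ ((fun κ : (CoordRing n × CoordRing m) × (ℕ × ℕ) × (ℤ × ℤ) =>
    leadTerm n m κ.2.1.1 κ.2.1.2 κ.1.1 κ.1.2) ''
      {κ | (κ.1.1 ∈ Covariants n ∧ κ.1.2 ∈ Covariants m) ∧
        κ.1.1.IsWeightedHomogeneous (ordWt n) κ.2.2.1 ∧
        κ.1.2.IsWeightedHomogeneous (ordWt m) κ.2.2.2})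

variable {n m}

theorem leadTerm_mem_leadSpan {U : CoordRing n} {W : CoordRing m} (hU : U ∈ Covariants n)
    (hW : W ∈ Covariants m) (i j : ℕ) : leadTerm n m i j U W ∈ leadSpan n m := by
  obtain ⟨S, hS⟩ := exists_finset_sum_component (ordWt n) U
  obtain ⟨T, hT⟩ := exists_finset_sum_component (ordWt m) W
  rw [hS, hT]
  simp only [leadTerm, map_sum, Finset.sum_mul, Finset.mul_sum]
  refine Submodule.sum_mem _ fun k _ => Submodule.sum_mem _ fun l _ => Submodule.subset_span ?_
  exact ⟨((weightedHomogeneousComponent (ordWt n) _ U, weightedHomogeneousComponent (ordWt m) _ W),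
    (i, j), (_, _)), ⟨⟨component_mem_covariants _ hU _, component_mem_covariants _ hW _⟩,
    weightedHomogeneousComponent_isWeightedHomogeneous _ _,
    weightedHomogeneousComponent_isWeightedHomogeneous _ _⟩, rfl⟩

theorem mul_mem_leadSpan {a : MvPolynomial (Σ i : ι₁, Fin (n i + 1)) ℂ}
    {b : MvPolynomial (Σ i : ι₂, Fin (m i + 1)) ℂ}
    (ha : ∀ t f, eval (vAct n (lower t) f) a = eval f a)
    (hb : ∀ t f, eval (vAct m (upper t) f) b = eval f b) (x : MvPolynomial (Fin 2) ℂ) :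
    rename (fun c => Sum.inl ⟨Sum.inl c.1, c.2⟩) a * (rename (fun c => Sum.inl ⟨Sum.inr c.1, c.2⟩) b
      * rename Sum.inr x) ∈ leadSpan n m := by
  obtain ⟨U, hU, hUa⟩ := exists_covariant_of_lower n ha
  obtain ⟨W, hW, hWb⟩ := exists_covariant_of_upper m hb
  have ha' : atVec n ![0, 1] U = a := MvPolynomial.funext fun f => by rw [eval_atVec, hUa]
  have hb' : atVec m ![1, 0] W = b := MvPolynomial.funext fun f => by rw [eval_atVec, hWb]
  rw [← ha', ← hb', as_sum x, map_sum, Finset.mul_sum, Finset.mul_sum]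
  refine Submodule.sum_mem _ fun d _ => ?_
  have : rename (fun c => Sum.inl ⟨Sum.inl c.1, c.2⟩) (atVec n ![0, 1] U)
      * (rename (fun c => Sum.inl ⟨Sum.inr c.1, c.2⟩) (atVec m ![1, 0] W)
      * rename Sum.inr (monomial d (coeff d x)))
      = coeff d x • leadTerm n m (d 1) (d 0) U W := by
    refine MvPolynomial.funext fun pt => ?_
    rw [smul_eval, leadTerm]
    simp only [map_mul, map_pow, eval_X, eval_rename, eval_monomial]
    rw [Finsupp.prod_fintype _ _ (by simp), Fin.prod_univ_two]
    simp only [Function.comp_apply]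
    ring
  rw [this]
  exact Submodule.smul_mem _ _ (leadTerm_mem_leadSpan hU hW _ _)

theorem mem_leadSpan_of_invariant {Q : CoordRing (Sum.elim n m)}
    (hl : ∀ t pt, eval (act3 n m (lower t) 1 1 pt) Q = eval pt Q)
    (hu : ∀ t pt, eval (act3 n m 1 (upper t) 1 pt) Q = eval pt Q) : Q ∈ leadSpan n m := by
  have hQ : Q = rename (joinVar n m) (rename (splitVar n m) Q) := by
    rw [rename_rename]
    conv_lhs => rw [← rename_id_apply Q]
    congr 1
    exact congrArg rename (funext fun c => (joinVar_splitVar n m c).symm)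
  have hsplit : ∀ p q, eval (Sum.elim p q) (rename (splitVar n m) Q)
      = eval (fun c => Sum.elim p q (splitVar n m c)) Q := fun p q => by
    rw [eval_rename]
    rfl
  have h1 := mem_span_mul_of_invariant (rename (splitVar n m) Q)
    (fun (t : ℂ) f => vAct n (lower t) f)
    (fun (t : ℂ) (y : (Σ i : ι₂, Fin (m i + 1)) ⊕ Fin 2 → ℂ) =>
      Sum.elim (vAct m (upper t) fun c => y (Sum.inl c)) fun i => y (Sum.inr i)) ?_ ?_
  · have h2 : rename (joinVar n m) (rename (splitVar n m) Q) ∈ (Submodule.span ℂ _).map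
        (rename (joinVar n m)).toLinearMap := Submodule.mem_map_of_mem h1
    rw [← hQ, Submodule.map_span] at h2
    refine (Submodule.span_le.2 ?_) h2
    rintro _ ⟨_, ⟨⟨a, b⟩, ⟨ha, hb⟩, rfl⟩, rfl⟩
    dsimp only at ha hb
    have h3 := mem_span_mul_of_invariant b (fun (t : ℂ) f => vAct m (upper t) f)
      (fun (_ : Unit) x => x) (fun t p q => ?_) (fun _ _ _ => rfl)
    · have h4 := Submodule.mem_map_of_mem (f := (LinearMap.mulLeft ℂ
        (rename (joinVar n m) (rename Sum.inl a))) ∘ₗ (rename (joinVar n m ∘ Sum.inr)).toLinearMap) h3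
      rw [Submodule.map_span] at h4
      have h5 : (AlgHom.toLinearMap (rename (joinVar n m))) (rename Sum.inl a * rename Sum.inr b)
          = ((LinearMap.mulLeft ℂ (rename (joinVar n m) (rename Sum.inl a)))
            ∘ₗ (rename (joinVar n m ∘ Sum.inr)).toLinearMap) b := by
        simp [rename_rename]
      change (AlgHom.toLinearMap (rename (joinVar n m))) (rename Sum.inl a * rename Sum.inr b) ∈ _
      rw [h5]
      refine (Submodule.span_le.2 ?_) h4
      rintro _ ⟨_, ⟨⟨b', x⟩, ⟨hb', -⟩, rfl⟩, rfl⟩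
      have h6 := mul_mem_leadSpan ha hb' x
      simpa [rename_rename, Function.comp_def, joinVar] using h6
    · exact hb t (Sum.elim p q)
  · intro t p q
    rw [hsplit, hsplit, ← hl t fun c => Sum.elim p q (splitVar n m c)]
    congr 2
    funext c
    rcases c with ⟨i | i, j⟩ | i
    · rfl
    · exact (congrFun (coeffAct_one (m i) fun k => q (Sum.inl ⟨i, k⟩)) j).symm
    · fin_cases i <;> simp [act3, actFam, splitVar]
  · intro t p q
    rw [hsplit, hsplit, ← hu t fun c => Sum.elim p q (splitVar n m c)]
    congr 2
    funext c
    rcases c with ⟨i | i, j⟩ | i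
    · exact (congrFun (coeffAct_one (n i) fun k => p ⟨i, k⟩) j).symm
    · rfl
    · fin_cases i <;> simp [act3, actFam, splitVar]

end

end GordanCov

namespace GordanCov

section
variable {ι₁ ι₂ : Type} {n : ι₁ → ℕ} {m : ι₂ → ℕ}

theorem eval_leadTerm_dil {U : CoordRing n} {W : CoordRing m} (hU : U ∈ Covariants n)
    (hW : W ∈ Covariants m) {a b : ℤ} (hUa : U.IsWeightedHomogeneous (ordWt n) a)
    (hWb : W.IsWeightedHomogeneous (ordWt m) b) (s : ℂˣ)
    (f : (Σ i : ι₁, Fin (n i + 1)) → ℂ) (g : (Σ i : ι₂, Fin (m i + 1)) → ℂ) :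
    eval (Sum.elim (vAct n (tau s) f) ![0, 1]) U = (s : ℂ) ^ a * eval (Sum.elim f ![0, 1]) U ∧
      eval (Sum.elim (vAct m (tau s) g) ![1, 0]) W
        = (s : ℂ) ^ (-b) * eval (Sum.elim g ![1, 0]) W := by
  have hs := s.ne_zero
  constructor
  · have h1 : Sum.elim (vAct n (tau s) f) ![0, 1]
        = ptAct n (tau s) (dil (ordWt n) s (Sum.elim f ![0, 1])) := by
      funext c
      rcases c with c | c
      · simp [ptAct, dil, ordWt, vAct]
      · fin_cases c <;> simp [ptAct, dil, ordWt, tau]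
    rw [h1, hU, eval_dil hUa]
  · have h1 : Sum.elim (vAct m (tau s) g) ![1, 0]
        = ptAct m (tau s) (dil (ordWt m) s⁻¹ (Sum.elim g ![1, 0])) := by
      funext c
      rcases c with c | c
      · simp [ptAct, dil, ordWt, vAct]
      · fin_cases c <;> simp [ptAct, dil, ordWt, tau]
    rw [h1, hW, eval_dil hWb, Units.val_inv_eq_inv_val, inv_zpow, zpow_neg]

theorem leadTerm_isWeightedHomogeneous_ordWt (i j : ℕ) (U : CoordRing n) (W : CoordRing m) :
    (leadTerm n m i j U W).IsWeightedHomogeneous (ordWt (Sum.elim n m)) (i + j : ℤ) := by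
  refine isWeightedHomogeneous_of_eval_dil fun s pt => ?_
  rw [eval_leadTerm, eval_leadTerm, zpow_add₀ s.ne_zero]
  simp only [dil, ordWt, Sum.elim_inl, Sum.elim_inr, zpow_zero, zpow_one, one_mul, mul_pow,
    zpow_natCast]
  ring

theorem leadTerm_isWeightedHomogeneous_antiWt {U : CoordRing n} {W : CoordRing m}
    (hU : U ∈ Covariants n) (hW : W ∈ Covariants m) {a b : ℤ}
    (hUa : U.IsWeightedHomogeneous (ordWt n) a) (hWb : W.IsWeightedHomogeneous (ordWt m) b)
    (i j : ℕ) :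
    (leadTerm n m i j U W).IsWeightedHomogeneous (antiWt n m) (a + b) := by
  refine isWeightedHomogeneous_of_eval_dil fun s pt => ?_
  rw [eval_leadTerm, eval_leadTerm, zpow_add₀ s.ne_zero]
  have h1 := (eval_leadTerm_dil hU hW hUa hWb s (fun c => pt (Sum.inl ⟨Sum.inl c.1, c.2⟩))
    (fun c => pt (Sum.inl ⟨Sum.inr c.1, c.2⟩))).1
  have h2 := (eval_leadTerm_dil hU hW hUa hWb s⁻¹ (fun c => pt (Sum.inl ⟨Sum.inl c.1, c.2⟩))
    (fun c => pt (Sum.inl ⟨Sum.inr c.1, c.2⟩))).2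
  rw [Units.val_inv_eq_inv_val, inv_zpow, zpow_neg, inv_inv] at h2
  have h3 : ∀ c : Σ i : ι₁, Fin (n i + 1), dil (antiWt n m) s pt (Sum.inl ⟨Sum.inl c.1, c.2⟩)
      = vAct n (tau s) (fun c => pt (Sum.inl ⟨Sum.inl c.1, c.2⟩)) c := fun c => by
    rw [dil_antiWt]
    rfl
  have h4 : ∀ c : Σ i : ι₂, Fin (m i + 1), dil (antiWt n m) s pt (Sum.inl ⟨Sum.inr c.1, c.2⟩)
      = vAct m (tau s⁻¹) (fun c => pt (Sum.inl ⟨Sum.inr c.1, c.2⟩)) c := fun c => by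
    rw [dil_antiWt]
    rfl
  have h5 : ∀ c, dil (antiWt n m) s pt (Sum.inr c) = pt (Sum.inr c) := fun c => by
    simp [dil, antiWt]
  simp only [h3, h4, h5]
  rw [h1, h2]
  ring

theorem leadTerm_isWeightedHomogeneous_diagWt {U : CoordRing n} {W : CoordRing m}
    (hU : U ∈ Covariants n) (hW : W ∈ Covariants m) {a b : ℤ}
    (hUa : U.IsWeightedHomogeneous (ordWt n) a) (hWb : W.IsWeightedHomogeneous (ordWt m) b)
    (i j : ℕ) :
    (leadTerm n m i j U W).IsWeightedHomogeneous (diagWt n m) (a + -b + -i + j) := by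
  refine isWeightedHomogeneous_of_eval_dil fun s pt => ?_
  rw [eval_leadTerm, eval_leadTerm, zpow_add₀ s.ne_zero, zpow_add₀ s.ne_zero, zpow_add₀ s.ne_zero]
  obtain ⟨h1, h2⟩ := eval_leadTerm_dil hU hW hUa hWb s (fun c => pt (Sum.inl ⟨Sum.inl c.1, c.2⟩))
    (fun c => pt (Sum.inl ⟨Sum.inr c.1, c.2⟩))
  have h3 : ∀ c : Σ i : ι₁, Fin (n i + 1), dil (diagWt n m) s pt (Sum.inl ⟨Sum.inl c.1, c.2⟩)
      = vAct n (tau s) (fun c => pt (Sum.inl ⟨Sum.inl c.1, c.2⟩)) c := fun c => by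
    rw [dil_diagWt]
    rfl
  have h4 : ∀ c : Σ i : ι₂, Fin (m i + 1), dil (diagWt n m) s pt (Sum.inl ⟨Sum.inr c.1, c.2⟩)
      = vAct m (tau s) (fun c => pt (Sum.inl ⟨Sum.inr c.1, c.2⟩)) c := fun c => by
    rw [dil_diagWt]
    rfl
  have h5 : dil (diagWt n m) s pt (Sum.inr 1) = (s : ℂ)⁻¹ * pt (Sum.inr 1) := by
    simp [dil, diagWt]
  have h6 : dil (diagWt n m) s pt (Sum.inr 0) = (s : ℂ) * pt (Sum.inr 0) := by
    simp [dil, diagWt]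
  simp only [h3, h4, h5, h6]
  rw [h1, h2, mul_pow, mul_pow, zpow_neg _ (i : ℤ), zpow_natCast, zpow_natCast, inv_pow]
  ring

theorem isWeightedHomogeneous_diagWt {P : CoordRing (Sum.elim n m)}
    (hP : P ∈ Covariants (Sum.elim n m)) : P.IsWeightedHomogeneous (diagWt n m) 0 := by
  refine isWeightedHomogeneous_of_eval_dil fun s pt => ?_
  rw [dil_diagWt, ← ptAct_eq_act3, hP, zpow_zero, one_mul]

theorem isWeightedHomogeneous_component {σ : Type*} {w w' : σ → ℤ} {P : MvPolynomial σ ℂ} {k : ℤ}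
    (hP : P.IsWeightedHomogeneous w k) (N : ℤ) :
    (weightedHomogeneousComponent w' N P).IsWeightedHomogeneous w k := by
  classical
  intro d hd
  rw [coeff_weightedHomogeneousComponent] at hd
  exact hP fun h => hd (by rw [h, ite_self])

variable (n m) in
/-- The span of the transvectants `⟨U, W⟩_r` of order `k` with `k + 2 r ≤ N`. -/
def transvSpan (k N : ℤ) : Submodule ℂ (CoordRing (Sum.elim n m)) :=
  Submodule.span ℂ {T | ∃ (u v r : ℕ) (U : CoordRing n) (W : CoordRing m), U ∈ Covariants n ∧
    W ∈ Covariants m ∧ U.IsWeightedHomogeneous (ordWt n) (u + r : ℕ) ∧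
    W.IsWeightedHomogeneous (ordWt m) (v + r : ℕ) ∧ (u : ℤ) + v = k ∧ k + 2 * r ≤ N ∧
    T = transvect (Sum.elim n m) (u + r) (v + r) r (embL n m U) (embR n m W)}

theorem transvSpan_mono {k N N' : ℤ} (h : N ≤ N') : transvSpan n m k N ≤ transvSpan n m k N' := by
  refine Submodule.span_mono ?_
  rintro T ⟨u, v, r, U, W, hU, hW, hUa, hWb, huv, hr, rfl⟩
  exact ⟨u, v, r, U, W, hU, hW, hUa, hWb, huv, hr.trans h, rfl⟩

theorem transvSpan_le_covariants {k N : ℤ} :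
    transvSpan n m k N ≤ (Covariants (Sum.elim n m)).toSubmodule := by
  refine Submodule.span_le.2 ?_
  rintro T ⟨u, v, r, U, W, hU, hW, hUa, hWb, huv, hr, rfl⟩
  exact transvect_mem_covariants (embL_mem _ _ hU) (embR_mem _ _ hW) _ _ _

theorem transvSpan_le_homogeneous {k N : ℤ} :
    transvSpan n m k N ≤ weightedHomogeneousSubmodule ℂ (ordWt (Sum.elim n m)) k := by
  refine Submodule.span_le.2 ?_
  rintro T ⟨u, v, r, U, W, hU, hW, hUa, hWb, rfl, hr, rfl⟩
  exact_mod_cast isWeightedHomogeneous_transvect (embL_isWeightedHomogeneous _ _ hUa)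
    (embR_isWeightedHomogeneous _ _ hWb)

/-- Every joint covariant has the same leading term as a combination of transvectants. -/
theorem exists_transvSpan_hasTop {P : CoordRing (Sum.elim n m)}
    (hP : P ∈ Covariants (Sum.elim n m)) {k N : ℤ}
    (hk : P.IsWeightedHomogeneous (ordWt (Sum.elim n m)) k)
    (hN : WeightLE (antiWt n m) N P) (hkN : k ≤ N) :
    ∃ P' ∈ transvSpan n m k N,
      HasTop (antiWt n m) N P' (weightedHomogeneousComponent (antiWt n m) N P) := by
  have h1 := mem_leadSpan_of_invariant (component_lower_invariant hP hN)
    (component_upper_invariant hP hN)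
  rw [leadSpan] at h1
  have h2 := mem_span_of_isWeightedHomogeneous (isWeightedHomogeneous_component hk N)
    (ω := fun κ => (κ.2.1.1 + κ.2.1.2 : ℤ))
    (fun κ _ => leadTerm_isWeightedHomogeneous_ordWt κ.2.1.1 κ.2.1.2 κ.1.1 κ.1.2) h1
  have h3 := mem_span_of_isWeightedHomogeneous
    (weightedHomogeneousComponent_isWeightedHomogeneous (w := antiWt n m) N P)
    (ω := fun κ => κ.2.2.1 + κ.2.2.2)
    (fun κ hκ => leadTerm_isWeightedHomogeneous_antiWt hκ.1.1.1 hκ.1.1.2 hκ.1.2.1 hκ.1.2.2 _ _) h2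
  have h4 := mem_span_of_isWeightedHomogeneous
    (isWeightedHomogeneous_component (isWeightedHomogeneous_diagWt hP) N)
    (ω := fun κ => κ.2.2.1 + -κ.2.2.2 + -κ.2.1.1 + κ.2.1.2)
    (fun κ hκ => leadTerm_isWeightedHomogeneous_diagWt hκ.1.1.1.1 hκ.1.1.1.2 hκ.1.1.2.1
      hκ.1.1.2.2 _ _) h3
  generalize weightedHomogeneousComponent (antiWt n m) N P = Q at h4
  clear h1 h2 h3
  induction h4 using Submodule.span_induction with
  | zero => exact ⟨0, Submodule.zero_mem _, HasTop.zero _ _⟩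
  | add x y _ _ hx hy =>
    obtain ⟨x', hx', hxt⟩ := hx
    obtain ⟨y', hy', hyt⟩ := hy
    exact ⟨_, Submodule.add_mem _ hx' hy', hxt.add hyt⟩
  | smul c x _ hx =>
    obtain ⟨x', hx', hxt⟩ := hx
    exact ⟨_, Submodule.smul_mem _ c hx', hxt.smul c⟩
  | mem x hx =>
    obtain ⟨⟨⟨U, W⟩, ⟨u, v⟩, a, b⟩, ⟨⟨⟨⟨⟨hU, hW⟩, hUa, hWb⟩, e1⟩, e2⟩, e3⟩, rfl⟩ := hx
    dsimp only at hU hW hUa hWb e1 e2 e3 ⊢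
    obtain ⟨r, hr⟩ : ∃ r : ℕ, a = ((u + r : ℕ) : ℤ) := ⟨(a - u).toNat, by push_cast; omega⟩
    have hb : b = ((v + r : ℕ) : ℤ) := by push_cast at hr ⊢; omega
    rw [hr] at hUa
    rw [hb] at hWb
    obtain ⟨c, hc, hct⟩ := exists_hasTop_transvect n m u v r
    refine ⟨c⁻¹ • transvect (Sum.elim n m) (u + r) (v + r) r (embL n m U) (embR n m W),
      Submodule.smul_mem _ _ (Submodule.subset_span ⟨u, v, r, U, W, hU, hW, hUa, hWb, e1,
        by push_cast at hr hb; omega, rfl⟩), ?_⟩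
    have h5 := (hct U hU W hW hUa hWb).smul c⁻¹
    rw [smul_smul, inv_mul_cancel₀ hc, one_smul] at h5
    rwa [← hr, ← hb, e2] at h5

/-- A joint covariant of order `k` and leading weight at most `N` is a combination of
transvectants. -/
theorem mem_transvSpan {k : ℤ} (j : ℕ) : ∀ {P : CoordRing (Sum.elim n m)},
    P ∈ Covariants (Sum.elim n m) → P.IsWeightedHomogeneous (ordWt (Sum.elim n m)) k →
    WeightLE (antiWt n m) (k - 1 + j) P → P ∈ transvSpan n m k (k - 1 + j) := by
  induction j with
  | zero =>
    intro P hP hk hN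
    rw [eq_zero_of_weightLE hP hk hN (by push_cast; omega)]
    exact Submodule.zero_mem _
  | succ j ih =>
    intro P hP hk hN
    obtain ⟨P', hP', hT⟩ := exists_transvSpan_hasTop hP hk hN (by push_cast; omega)
    have h1 := hN.hasTop.sub hT
    rw [sub_self] at h1
    have h2 := ih (Subalgebra.sub_mem _ hP (transvSpan_le_covariants hP'))
      (Submodule.sub_mem (weightedHomogeneousSubmodule ℂ (ordWt (Sum.elim n m)) k) hk
        (transvSpan_le_homogeneous hP'))
      (by
        have h3 := h1.weightLE_of_zero
        push_cast at h3 ⊢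
        rwa [show k - 1 + ((j : ℤ) + 1) - 1 = k - 1 + j by ring] at h3)
    have h4 := Submodule.add_mem _ (transvSpan_mono (by push_cast; omega) h2) hP'
    rwa [sub_add_cancel] at h4

theorem mem_transvSpan_of_weightLE {k N : ℤ} {P : CoordRing (Sum.elim n m)}
    (hP : P ∈ Covariants (Sum.elim n m)) (hk : P.IsWeightedHomogeneous (ordWt (Sum.elim n m)) k)
    (hN : WeightLE (antiWt n m) N P) : P ∈ transvSpan n m k N := by
  by_cases h : k ≤ N
  · obtain ⟨j, rfl⟩ : ∃ j : ℕ, N = k - 1 + j := ⟨(N - (k - 1)).toNat, by omega⟩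
    exact mem_transvSpan j hP hk hN
  · rw [eq_zero_of_weightLE hP hk hN (not_le.1 h)]
    exact Submodule.zero_mem _

end

end GordanCov

namespace GordanCov

theorem isWeightedHomogeneous_ordWt_of_wBi {ι : Type} {ν : ι → ℕ} {P : CoordRing ν} {d a : ℕ}
    (hP : P.IsWeightedHomogeneous (wBi ν) (d, a)) : P.IsWeightedHomogeneous (ordWt ν) a := by
  intro c hc
  have h := congrArg Prod.snd (hP hc)
  rw [Finsupp.weight_apply, Finsupp.sum, Prod.snd_sum] at h
  rw [Finsupp.weight_apply, Finsupp.sum]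
  dsimp only at h
  rw [← h, Nat.cast_sum]
  refine Finset.sum_congr rfl fun x _ => ?_
  rcases x with x | x <;> simp [ordWt, wBi]

theorem prod_pow_isWeightedHomogeneous {ι : Type} {ν : ι → ℕ} {p : ℕ} {f : Fin p → CoordRing ν}
    {a : Fin p → ℕ} (hf : ∀ i, (f i).IsWeightedHomogeneous (ordWt ν) (a i)) (α : Fin p → ℕ) :
    (∏ i, f i ^ α i).IsWeightedHomogeneous (ordWt ν) ((∑ i, a i * α i : ℕ) : ℤ) := by
  have h := IsWeightedHomogeneous.prod Finset.univ (fun i => f i ^ α i) (fun i => α i • (a i : ℤ))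
    (w := ordWt ν) fun i _ => (hf i).pow (α i)
  convert h using 1
  push_cast
  refine Finset.sum_congr rfl fun i _ => ?_
  rw [nsmul_eq_mul, mul_comm]

theorem mem_span_prod_pow {ι : Type} {ν : ι → ℕ} {p : ℕ} {f : Fin p → CoordRing ν}
    {a : Fin p → ℕ} (hf : ∀ i, (f i).IsWeightedHomogeneous (ordWt ν) (a i))
    (hgen : Covariants ν = Algebra.adjoin ℂ (Set.range f)) {U : CoordRing ν}
    (hU : U ∈ Covariants ν) {k : ℕ} (hk : U.IsWeightedHomogeneous (ordWt ν) k) :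
    U ∈ Submodule.span ℂ ((fun α : Fin p → ℕ => ∏ i, f i ^ α i) '' {α | ∑ i, a i * α i = k}) := by
  have h1 : U ∈ Submodule.span ℂ ((fun α : Fin p → ℕ => ∏ i, f i ^ α i) '' Set.univ) := by
    rw [hgen, Algebra.adjoin_range_eq_range_aeval] at hU
    obtain ⟨P, rfl⟩ := hU
    change aeval f P ∈ _
    rw [as_sum P, map_sum]
    refine Submodule.sum_mem _ fun d _ => ?_
    rw [aeval_monomial, ← Algebra.smul_def]
    refine Submodule.smul_mem _ _ (Submodule.subset_span ⟨d, trivial, ?_⟩)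
    rw [Finsupp.prod_fintype _ _ fun i => pow_zero _]
  have h2 := mem_span_of_isWeightedHomogeneous hk
    (fun α _ => prod_pow_isWeightedHomogeneous hf α) h1
  refine Submodule.span_mono (Set.image_mono ?_) h2
  rintro α ⟨-, h⟩
  exact_mod_cast h

section
variable {ι₁ ι₂ : Type} {n : ι₁ → ℕ} {m : ι₂ → ℕ}

theorem transvSpan_le {S : Submodule ℂ (CoordRing (Sum.elim n m))} {k N : ℤ}
    (h : ∀ (u v r : ℕ) (U : CoordRing n) (W : CoordRing m), U ∈ Covariants n →
      W ∈ Covariants m → U.IsWeightedHomogeneous (ordWt n) (u + r : ℕ) →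
      W.IsWeightedHomogeneous (ordWt m) (v + r : ℕ) → k + 2 * r ≤ N →
      transvect (Sum.elim n m) (u + r) (v + r) r (embL n m U) (embR n m W) ∈ S) :
    transvSpan n m k N ≤ S := by
  refine Submodule.span_le.2 ?_
  rintro T ⟨u, v, r, U, W, hU, hW, hUa, hWb, -, hr, rfl⟩
  exact h u v r U W hU hW hUa hWb hr

/-- The transvectant of products is, up to a scalar and transvectants of smaller index, the product
of transvectants. -/
theorem transvect_mul_mem {S : Subalgebra ℂ (CoordRing (Sum.elim n m))}
    {u₁ v₁ r₁ u₂ v₂ r₂ : ℕ} {U₁ U₂ : CoordRing n} {W₁ W₂ : CoordRing m}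
    (hU₁ : U₁ ∈ Covariants n) (hU₂ : U₂ ∈ Covariants n)
    (hW₁ : W₁ ∈ Covariants m) (hW₂ : W₂ ∈ Covariants m)
    (hUa₁ : U₁.IsWeightedHomogeneous (ordWt n) (u₁ + r₁ : ℕ))
    (hUa₂ : U₂.IsWeightedHomogeneous (ordWt n) (u₂ + r₂ : ℕ))
    (hWb₁ : W₁.IsWeightedHomogeneous (ordWt m) (v₁ + r₁ : ℕ))
    (hWb₂ : W₂.IsWeightedHomogeneous (ordWt m) (v₂ + r₂ : ℕ))
    (hS : ∀ (u v r : ℕ) (U : CoordRing n) (W : CoordRing m), U ∈ Covariants n →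
      W ∈ Covariants m → U.IsWeightedHomogeneous (ordWt n) (u + r : ℕ) →
      W.IsWeightedHomogeneous (ordWt m) (v + r : ℕ) → r < r₁ + r₂ →
      transvect (Sum.elim n m) (u + r) (v + r) r (embL n m U) (embR n m W) ∈ S)
    (h₁ : transvect (Sum.elim n m) (u₁ + r₁) (v₁ + r₁) r₁ (embL n m U₁) (embR n m W₁) ∈ S)
    (h₂ : transvect (Sum.elim n m) (u₂ + r₂) (v₂ + r₂) r₂ (embL n m U₂) (embR n m W₂) ∈ S) :
    transvect (Sum.elim n m) (u₁ + u₂ + (r₁ + r₂)) (v₁ + v₂ + (r₁ + r₂)) (r₁ + r₂)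
      (embL n m (U₁ * U₂)) (embR n m (W₁ * W₂)) ∈ S := by
  obtain ⟨c₁, hc₁, ht₁⟩ := exists_hasTop_transvect n m u₁ v₁ r₁
  obtain ⟨c₂, hc₂, ht₂⟩ := exists_hasTop_transvect n m u₂ v₂ r₂
  obtain ⟨c, hc, ht⟩ := exists_hasTop_transvect n m (u₁ + u₂) (v₁ + v₂) (r₁ + r₂)
  have hU := Subalgebra.mul_mem _ hU₁ hU₂
  have hW := Subalgebra.mul_mem _ hW₁ hW₂
  have hUa : (U₁ * U₂).IsWeightedHomogeneous (ordWt n) (u₁ + u₂ + (r₁ + r₂) : ℕ) := by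
    convert hUa₁.mul hUa₂ using 1
    push_cast
    ring
  have hWb : (W₁ * W₂).IsWeightedHomogeneous (ordWt m) (v₁ + v₂ + (r₁ + r₂) : ℕ) := by
    convert hWb₁.mul hWb₂ using 1
    push_cast
    ring
  have ht₁ := ht₁ U₁ hU₁ W₁ hW₁ hUa₁ hWb₁
  have ht₂ := ht₂ U₂ hU₂ W₂ hW₂ hUa₂ hWb₂
  have ht := ht _ hU _ hW hUa hWb
  have hT₁ := transvect_mem_covariants (embL_mem n m hU₁) (embR_mem n m hW₁) (u₁ + r₁) (v₁ + r₁) r₁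
  have hT₂ := transvect_mem_covariants (embL_mem n m hU₂) (embR_mem n m hW₂) (u₂ + r₂) (v₂ + r₂) r₂
  have hT := transvect_mem_covariants (embL_mem n m hU) (embR_mem n m hW)
    (u₁ + u₂ + (r₁ + r₂)) (v₁ + v₂ + (r₁ + r₂)) (r₁ + r₂)
  have hk₁ := isWeightedHomogeneous_transvect (embL_isWeightedHomogeneous n m hUa₁)
    (embR_isWeightedHomogeneous n m hWb₁)
  have hk₂ := isWeightedHomogeneous_transvect (embL_isWeightedHomogeneous n m hUa₂)
    (embR_isWeightedHomogeneous n m hWb₂)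
  have hk := isWeightedHomogeneous_transvect (embL_isWeightedHomogeneous n m hUa)
    (embR_isWeightedHomogeneous n m hWb)
  generalize transvect (Sum.elim n m) (u₁ + r₁) (v₁ + r₁) r₁ (embL n m U₁) (embR n m W₁) = T₁ at *
  generalize transvect (Sum.elim n m) (u₂ + r₂) (v₂ + r₂) r₂ (embL n m U₂) (embR n m W₂) = T₂ at *
  generalize transvect (Sum.elim n m) (u₁ + u₂ + (r₁ + r₂)) (v₁ + v₂ + (r₁ + r₂)) (r₁ + r₂)
      (embL n m (U₁ * U₂)) (embR n m (W₁ * W₂)) = T at *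
  have hN : ((u₁ + r₁ : ℕ) + (v₁ + r₁ : ℕ) : ℤ) + ((u₂ + r₂ : ℕ) + (v₂ + r₂ : ℕ))
      = ((u₁ + u₂ + (r₁ + r₂) : ℕ) : ℤ) + (v₁ + v₂ + (r₁ + r₂) : ℕ) := by
    push_cast
    ring
  have hD := ht₁.mul ht₂
  rw [hN, smul_mul_smul_comm, leadTerm_mul] at hD
  have hD' := hD.sub (ht.smul (c₁ * c₂ * c⁻¹))
  rw [smul_smul, inv_mul_cancel_right₀ hc, sub_self] at hD'
  have hmem : T₁ * T₂ - (c₁ * c₂ * c⁻¹) • T ∈ S := by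
    have hkm : (T₁ * T₂).IsWeightedHomogeneous (ordWt (Sum.elim n m)) (u₁ + u₂ + (v₁ + v₂) : ℕ) := by
      convert hk₁.mul hk₂ using 1
      push_cast
      ring
    have h3 := mem_transvSpan_of_weightLE
      (Subalgebra.sub_mem _ (Subalgebra.mul_mem _ hT₁ hT₂)
        (Subalgebra.smul_mem _ hT (c₁ * c₂ * c⁻¹)))
      (Submodule.sub_mem (weightedHomogeneousSubmodule ℂ (ordWt (Sum.elim n m)) _) hkm
        (Submodule.smul_mem _ (c₁ * c₂ * c⁻¹) hk)) hD'.weightLE_of_zero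
    exact transvSpan_le (S := S.toSubmodule) (fun u v r U W hU hW hUa hWb hr =>
      hS u v r U W hU hW hUa hWb (by push_cast at hr; omega)) h3
  have hTeq : T = (c₁ * c₂ * c⁻¹)⁻¹ • (T₁ * T₂ - (T₁ * T₂ - (c₁ * c₂ * c⁻¹) • T)) := by
    rw [sub_sub_cancel, smul_smul, inv_mul_cancel₀, one_smul]
    exact mul_ne_zero (mul_ne_zero hc₁ hc₂) (inv_ne_zero hc)
  rw [hTeq]
  exact S.smul_mem (S.sub_mem (S.mul_mem h₁ h₂) hmem) _

/-- Membership of transvectants in a subalgebra can be checked on monomials in generators. -/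
theorem transvect_mem_of_monomials {p q : ℕ} {f : Fin p → CoordRing n} {g : Fin q → CoordRing m}
    {a : Fin p → ℕ} {b : Fin q → ℕ}
    (hf : ∀ i, (f i).IsWeightedHomogeneous (ordWt n) (a i))
    (hg : ∀ i, (g i).IsWeightedHomogeneous (ordWt m) (b i))
    (hfgen : Covariants n = Algebra.adjoin ℂ (Set.range f))
    (hggen : Covariants m = Algebra.adjoin ℂ (Set.range g))
    {S : Subalgebra ℂ (CoordRing (Sum.elim n m))} {u v r : ℕ}
    (h : ∀ (α : Fin p → ℕ) (β : Fin q → ℕ), ∑ i, a i * α i = u + r → ∑ j, b j * β j = v + r →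
      transvect (Sum.elim n m) (u + r) (v + r) r (embL n m (∏ i, f i ^ α i))
        (embR n m (∏ j, g j ^ β j)) ∈ S)
    {U : CoordRing n} {W : CoordRing m} (hU : U ∈ Covariants n) (hW : W ∈ Covariants m)
    (hUa : U.IsWeightedHomogeneous (ordWt n) (u + r : ℕ))
    (hWb : W.IsWeightedHomogeneous (ordWt m) (v + r : ℕ)) :
    transvect (Sum.elim n m) (u + r) (v + r) r (embL n m U) (embR n m W) ∈ S := by
  have h1 := mem_span_prod_pow hf hfgen hU hUa
  have h2 := mem_span_prod_pow hg hggen hW hWb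
  have h3 := Submodule.apply_mem_map₂ ((transvectBilin (Sum.elim n m) (u + r) (v + r) r).compl₁₂
    (embL n m).toLinearMap (embR n m).toLinearMap) h1 h2
  rw [Submodule.map₂_span_span] at h3
  rw [← transvectBilin_apply]
  refine (Submodule.span_le (p := S.toSubmodule)).2 ?_ h3
  rintro _ ⟨_, ⟨α, hα, rfl⟩, _, ⟨β, hβ, rfl⟩, rfl⟩
  have h4 := h α β hα hβ
  rwa [← transvectBilin_apply] at h4

end

/-- Gordan's Diophantine system has finitely many irreducible solutions. -/
theorem finite_irreducible {p q : ℕ} (a : Fin p → ℕ) (b : Fin q → ℕ) :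
    {κ : (Fin p → ℕ) × (Fin q → ℕ) × ℕ × ℕ × ℕ | IsIrreducibleGordanSol a b κ}.Finite := by
  have hanti : IsAntichain (· ≤ ·)
      {κ : (Fin p → ℕ) × (Fin q → ℕ) × ℕ × ℕ × ℕ | IsIrreducibleGordanSol a b κ} := by
    intro κ hκ κ' hκ' hne hle
    obtain ⟨δ, rfl⟩ := exists_add_of_le hle
    refine hκ'.2.2 κ δ hκ.1 ?_ hκ.2.1 (fun h => hne (by rw [h, add_zero])) rfl
    have h1 := hκ.1
    have h2 := hκ'.1
    simp only [IsGordanSol, Prod.fst_add, Prod.snd_add, Pi.add_apply, mul_add,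
      Finset.sum_add_distrib] at h1 h2 ⊢
    omega
  exact hanti.finite_of_partiallyWellOrderedOn (Set.isPWO_of_wellQuasiOrderedLE _)

/-- The sum of the entries of a solution. -/
def solSize {p q : ℕ} (κ : (Fin p → ℕ) × (Fin q → ℕ) × ℕ × ℕ × ℕ) : ℕ :=
  ∑ i, κ.1 i + ∑ j, κ.2.1 j + κ.2.2.1 + κ.2.2.2.1 + κ.2.2.2.2

theorem solSize_add {p q : ℕ} (κ κ' : (Fin p → ℕ) × (Fin q → ℕ) × ℕ × ℕ × ℕ) :
    solSize (κ + κ') = solSize κ + solSize κ' := by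
  simp only [solSize, Prod.fst_add, Prod.snd_add, Pi.add_apply, Finset.sum_add_distrib]
  ring

theorem solSize_pos {p q : ℕ} {κ : (Fin p → ℕ) × (Fin q → ℕ) × ℕ × ℕ × ℕ} (h : κ ≠ 0) :
    0 < solSize κ := by
  refine Nat.pos_of_ne_zero fun h0 => h ?_
  obtain ⟨α, β, u, v, r⟩ := κ
  simp only [solSize, Nat.add_eq_zero_iff, Finset.sum_eq_zero_iff, Finset.mem_univ,
    true_implies] at h0
  obtain ⟨⟨⟨⟨h1, h2⟩, rfl⟩, rfl⟩, rfl⟩ := h0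
  rw [show α = 0 from funext h1, show β = 0 from funext h2]
  rfl

end GordanCov

/-- **Gordan's theorem for joint covariants.** Let `V₁, V₂` be spaces of binary
forms and `A = {f 0, …}`, `B = {g 0, …}` finite generating sets of homogeneous
covariants of `Cov(V₁)`, `Cov(V₂)`, of orders `a i` and `b j`. Then the set of
irreducible solutions of the linear Diophantine system `S(A,B)` is finite and
`Cov(V₁ ⊕ V₂)` is generated as a `ℂ`-algebra by the finitely many transvectants
`⟨∏ f^α, ∏ g^β⟩_r` associated to the irreducible solutions `(α, β, u, v, r)`. -/
theorem gordan_joint_covariants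
    (s t : ℕ) (n : Fin s → ℕ) (m : Fin t → ℕ)
    (p q : ℕ) (f : Fin p → CoordRing n) (g : Fin q → CoordRing m)
    (d a : Fin p → ℕ) (e b : Fin q → ℕ)
    (hfc : ∀ i, f i ∈ Covariants n) (hgc : ∀ j, g j ∈ Covariants m)
    (hfh : ∀ i, (f i).IsWeightedHomogeneous (wBi n) (d i, a i))
    (hgh : ∀ j, (g j).IsWeightedHomogeneous (wBi m) (e j, b j))
    (hfgen : Covariants n = Algebra.adjoin ℂ (Set.range f))
    (hggen : Covariants m = Algebra.adjoin ℂ (Set.range g)) :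
    {κ : (Fin p → ℕ) × (Fin q → ℕ) × ℕ × ℕ × ℕ |
        IsIrreducibleGordanSol a b κ}.Finite ∧
    Covariants (Sum.elim n m) = Algebra.adjoin ℂ
      ((fun κ : (Fin p → ℕ) × (Fin q → ℕ) × ℕ × ℕ × ℕ =>
          transvect (Sum.elim n m) (κ.2.2.1 + κ.2.2.2.2) (κ.2.2.2.1 + κ.2.2.2.2)
            κ.2.2.2.2
            (embL n m (∏ i, f i ^ κ.1 i)) (embR n m (∏ j, g j ^ κ.2.1 j))) ''
        {κ | IsIrreducibleGordanSol a b κ}) := by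
  have hfo : ∀ i, (f i).IsWeightedHomogeneous (GordanCov.ordWt n) (a i) := fun i =>
    GordanCov.isWeightedHomogeneous_ordWt_of_wBi (hfh i)
  have hgo : ∀ j, (g j).IsWeightedHomogeneous (GordanCov.ordWt m) (b j) := fun j =>
    GordanCov.isWeightedHomogeneous_ordWt_of_wBi (hgh j)
  have hfm : ∀ α : Fin p → ℕ, ∏ i, f i ^ α i ∈ Covariants n := fun α =>
    Subalgebra.prod_mem _ fun i _ => Subalgebra.pow_mem _ (hfc i) _
  have hgm : ∀ β : Fin q → ℕ, ∏ j, g j ^ β j ∈ Covariants m := fun β =>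
    Subalgebra.prod_mem _ fun j _ => Subalgebra.pow_mem _ (hgc j) _
  refine ⟨GordanCov.finite_irreducible a b, le_antisymm ?_ (Algebra.adjoin_le ?_)⟩
  swap
  · rintro _ ⟨κ, -, rfl⟩
    exact GordanCov.transvect_mem_covariants (GordanCov.embL_mem _ _ (hfm _))
      (GordanCov.embR_mem _ _ (hgm _)) _ _ _
  set S := Algebra.adjoin ℂ
      ((fun κ : (Fin p → ℕ) × (Fin q → ℕ) × ℕ × ℕ × ℕ =>
          transvect (Sum.elim n m) (κ.2.2.1 + κ.2.2.2.2) (κ.2.2.2.1 + κ.2.2.2.2)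
            κ.2.2.2.2
            (embL n m (∏ i, f i ^ κ.1 i)) (embR n m (∏ j, g j ^ κ.2.1 j))) ''
        {κ | IsIrreducibleGordanSol a b κ}) with hS
  have hmono : ∀ r N : ℕ, ∀ κ : (Fin p → ℕ) × (Fin q → ℕ) × ℕ × ℕ × ℕ, IsGordanSol a b κ →
      κ.2.2.2.2 = r → GordanCov.solSize κ = N →
      transvect (Sum.elim n m) (κ.2.2.1 + κ.2.2.2.2) (κ.2.2.2.1 + κ.2.2.2.2) κ.2.2.2.2
        (embL n m (∏ i, f i ^ κ.1 i)) (embR n m (∏ j, g j ^ κ.2.1 j)) ∈ S := by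
    intro r
    induction r using Nat.strong_induction_on with
    | _ r ihr =>
      intro N
      induction N using Nat.strong_induction_on with
      | _ N ihN =>
        intro κ hκ hr hN
        by_cases h0 : κ = 0
        · subst h0
          have h1 : transvect (Sum.elim n m) 0 0 0 1 1 ∈ S := by
            rw [GordanCov.transvect_one_one]
            exact S.one_mem
          simpa using h1
        by_cases hirr : IsIrreducibleGordanSol a b κ
        · exact Algebra.subset_adjoin ⟨κ, hirr, rfl⟩
        obtain ⟨κ₁, κ₂, hκ₁, hκ₂, h₁, h₂, rfl⟩ : ∃ κ₁ κ₂, IsGordanSol a b κ₁ ∧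
            IsGordanSol a b κ₂ ∧ κ₁ ≠ 0 ∧ κ₂ ≠ 0 ∧ κ = κ₁ + κ₂ := by
          by_contra! hcon
          exact hirr ⟨hκ, h0, hcon⟩
        have hs := GordanCov.solSize_add κ₁ κ₂
        have hs₁ := GordanCov.solSize_pos h₁
        have hs₂ := GordanCov.solSize_pos h₂
        have hr' : κ₁.2.2.2.2 + κ₂.2.2.2.2 = r := hr
        have hmem : ∀ κ : (Fin p → ℕ) × (Fin q → ℕ) × ℕ × ℕ × ℕ, IsGordanSol a b κ →
            κ.2.2.2.2 ≤ r → GordanCov.solSize κ < N →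
            transvect (Sum.elim n m) (κ.2.2.1 + κ.2.2.2.2) (κ.2.2.2.1 + κ.2.2.2.2) κ.2.2.2.2
              (embL n m (∏ i, f i ^ κ.1 i)) (embR n m (∏ j, g j ^ κ.2.1 j)) ∈ S := by
          intro κ hκ hle hlt
          rcases hle.lt_or_eq with h | h
          · exact ihr _ h _ κ hκ rfl rfl
          · exact ihN _ hlt κ hκ h rfl
        have hU : ∀ κ : (Fin p → ℕ) × (Fin q → ℕ) × ℕ × ℕ × ℕ, IsGordanSol a b κ →
            (∏ i, f i ^ κ.1 i).IsWeightedHomogeneous (GordanCov.ordWt n)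
              (κ.2.2.1 + κ.2.2.2.2 : ℕ) := fun κ hκ => by
          rw [← hκ.1]
          exact GordanCov.prod_pow_isWeightedHomogeneous hfo _
        have hW : ∀ κ : (Fin p → ℕ) × (Fin q → ℕ) × ℕ × ℕ × ℕ, IsGordanSol a b κ →
            (∏ j, g j ^ κ.2.1 j).IsWeightedHomogeneous (GordanCov.ordWt m)
              (κ.2.2.2.1 + κ.2.2.2.2 : ℕ) := fun κ hκ => by
          rw [← hκ.2]
          exact GordanCov.prod_pow_isWeightedHomogeneous hgo _
        have key := GordanCov.transvect_mul_mem (S := S) (hfm κ₁.1) (hfm κ₂.1) (hgm κ₁.2.1)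
          (hgm κ₂.2.1) (hU κ₁ hκ₁) (hU κ₂ hκ₂) (hW κ₁ hκ₁) (hW κ₂ hκ₂)
          (fun u v r' U W hU hW hUa hWb hlt =>
            GordanCov.transvect_mem_of_monomials hfo hgo hfgen hggen (fun α β hα hβ =>
              ihr r' (hr' ▸ hlt) _ (α, β, u, v, r') ⟨hα, hβ⟩ rfl rfl) hU hW hUa hWb)
          (hmem κ₁ hκ₁ (by omega) (by omega)) (hmem κ₂ hκ₂ (by omega) (by omega))
        simpa only [Prod.fst_add, Prod.snd_add, Pi.add_apply, pow_add,
          Finset.prod_mul_distrib] using key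
  intro P hP
  obtain ⟨K, hK⟩ := GordanCov.exists_finset_sum_component (GordanCov.ordWt (Sum.elim n m)) P
  rw [hK]
  refine Subalgebra.sum_mem _ fun k _ => ?_
  obtain ⟨N, hN⟩ := GordanCov.exists_weightLE (GordanCov.antiWt n m)
    (weightedHomogeneousComponent (GordanCov.ordWt (Sum.elim n m)) k P)
  exact GordanCov.transvSpan_le (S := S.toSubmodule)
    (fun u v r U W hU hW hUa hWb _ =>
      GordanCov.transvect_mem_of_monomials hfo hgo hfgen hggen (fun α β hα hβ =>
        hmono r _ (α, β, u, v, r) ⟨hα, hβ⟩ rfl rfl) hU hW hUa hWb)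
    (GordanCov.mem_transvSpan_of_weightLE (GordanCov.component_mem_covariants _ hP k)
      (weightedHomogeneousComponent_isWeightedHomogeneous k P) hN)
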